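/- arXiv:1504.02992 — 3 statements merged into one kernel-verified Lean document; each statement's English description precedes it below -/
import Mathlib

section
/- Let G = (V,D,B) be an acyclic mixed graph and let v ∈ V. Suppose Y ⊆ V satisfies the half-trek criterion with respect to v, and suppose that for each y ∈ Y the vector of coefficients Λ_{pa(y),y} is generically identifiable in G. Then Λ_{pa(v),v} is generically identifiable in G. -/
open scoped Classical Matrix

/-- The directed part of the graph contains no directed cycle. -/
def Acyclic {n : ℕ} (D : Finset (Fin n × Fin n)) : Prop :=
  ∀ v : Fin n, ¬ Relation.TransGen (fun a b => (a, b) ∈ D) v v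

/-- Mixed graph axioms: the bidirected edge set is symmetric and there are no self loops. -/
def IsMixedGraph {n : ℕ} (D B : Finset (Fin n × Fin n)) : Prop :=
  (∀ v w : Fin n, (v, w) ∈ B → (w, v) ∈ B) ∧ ∀ v : Fin n, (v, v) ∉ D ∧ (v, v) ∉ B

/-- `IsTrek D B v w L R`: `L` is the left side of a trek from `v` to `w`, listed from the top
node down to the source `v` (consecutive vertices joined by directed edges pointing towards
`v`); `R` is the right side, listed from the top down to the target `w`.  Either the two tops
coincide (no bidirected edge) or they are joined by a bidirected edge. -/
def IsTrek {n : ℕ} (D B : Finset (Fin n × Fin n)) (v w : Fin n)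
    (L R : List (Fin n)) : Prop :=
  L ≠ [] ∧ R ≠ [] ∧
    L.Chain' (fun a b => (a, b) ∈ D) ∧ R.Chain' (fun a b => (a, b) ∈ D) ∧
    L.getLast? = some v ∧ R.getLast? = some w ∧
    (L.head? = R.head? ∨
      ∃ u z : Fin n, L.head? = some u ∧ R.head? = some z ∧ (u, z) ∈ B)

/-- Product of the matrix entries `Λ x y` over the consecutive pairs `(x, y)` of a list,
i.e. the product of the directed-edge coefficients along a directed path. -/
noncomputable def edgeProd {n : ℕ} (Λ : Matrix (Fin n) (Fin n) ℝ) :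
    List (Fin n) → ℝ
  | [] => 1
  | [_] => 1
  | x :: y :: rest => Λ x y * edgeProd Λ (y :: rest)

/-- The trek monomial of the trek with sides `L`, `R`. -/
noncomputable def trekWeight {n : ℕ} (Λ Ω : Matrix (Fin n) (Fin n) ℝ)
    (L R : List (Fin n)) : ℝ :=
  (match L.head?, R.head? with
    | some u, some z => Ω u z
    | _, _ => 0) * edgeProd Λ L * edgeProd Λ R

/-- `u` is an ancestor of `v`: there is a (possibly empty) directed path from `u` to `v`. -/
def IsAncestor {n : ℕ} (D : Finset (Fin n × Fin n)) (u v : Fin n) : Prop :=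
  Relation.ReflTransGen (fun a b => (a, b) ∈ D) u v

/-- `V'` is an ancestral subset: it contains all ancestors of its members. -/
def Ancestral {n : ℕ} (D : Finset (Fin n × Fin n)) (V' : Finset (Fin n)) : Prop :=
  ∀ u v : Fin n, IsAncestor D u v → v ∈ V' → u ∈ V'

/-- The parents of `v`. -/
def paF {n : ℕ} (D : Finset (Fin n × Fin n)) (v : Fin n) : Finset (Fin n) :=
  Finset.univ.filter fun w => (w, v) ∈ D

/-- `htr D B v`: the set of vertices `w ∉ {v} ∪ sib(v)` reachable from `v` by a half-trek. -/
def htr {n : ℕ} (D B : Finset (Fin n × Fin n)) (v : Fin n) : Set (Fin n) :=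
  {w | w ≠ v ∧ (v, w) ∉ B ∧ ∃ R, IsTrek D B v w [v] R}

/-- `Y` satisfies the half-trek criterion with respect to `v`: `|Y| = |pa(v)|`,
`Y ∩ ({v} ∪ sib(v)) = ∅`, and there is a system of half-treks with no sided intersection
from `Y` to `pa(v)` (given by a source `src p ∈ Y` and a right side `R p` for each parent
`p`, with pairwise distinct sources and pairwise disjoint right sides). -/
def SatisfiesHTC {n : ℕ} (D B : Finset (Fin n × Fin n)) (v : Fin n)
    (Y : Finset (Fin n)) : Prop :=
  Y.card = (paF D v).card ∧
    (∀ y ∈ Y, y ≠ v ∧ (y, v) ∉ B) ∧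
    ∃ (src : Fin n → Fin n) (R : Fin n → List (Fin n)),
      (∀ p ∈ paF D v, src p ∈ Y ∧ IsTrek D B (src p) p [src p] (R p)) ∧
      ∀ p ∈ paF D v, ∀ q ∈ paF D v, p ≠ q →
        src p ≠ src q ∧ ∀ x ∈ R p, x ∉ R q

/-- The parameter space `Θ = ℝ^D × PD(B)`. -/
def Theta {α : Type} [Fintype α] (D B : Set (α × α)) :
    Set (Matrix α α ℝ × Matrix α α ℝ) :=
  {p : Matrix α α ℝ × Matrix α α ℝ |
    (∀ v w : α, p.1 v w ≠ 0 → (v, w) ∈ D) ∧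
      p.2.PosDef ∧ ∀ v w : α, v ≠ w → p.2 v w ≠ 0 → (v, w) ∈ B}

/-- The parameterization map `φ(Λ, Ω) = (I - Λ)⁻ᵀ Ω (I - Λ)⁻¹`. -/
noncomputable def phi {α : Type} [Fintype α] [DecidableEq α]
    (p : Matrix α α ℝ × Matrix α α ℝ) : Matrix α α ℝ :=
  ((1 - p.1)⁻¹)ᵀ * p.2 * (1 - p.1)⁻¹

/-- Evaluation of a polynomial in the entries of the two parameter matrices. -/
noncomputable def polyEval {α : Type} [Fintype α]
    (f : MvPolynomial ((α × α) ⊕ (α × α)) ℝ)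
    (p : Matrix α α ℝ × Matrix α α ℝ) : ℝ :=
  MvPolynomial.eval (Sum.elim (fun e => p.1 e.1 e.2) (fun e => p.2 e.1 e.2)) f

/-- `A` is a proper algebraic subset of `Θ`: the intersection of `Θ` with the zero set of a
polynomial in the matrix entries that does not vanish identically on `Θ`. -/
def IsProperAlg {α : Type} [Fintype α]
    (Θ A : Set (Matrix α α ℝ × Matrix α α ℝ)) : Prop :=
  ∃ f : MvPolynomial ((α × α) ⊕ (α × α)) ℝ,
    (∃ p ∈ Θ, polyEval f p ≠ 0) ∧ A = {p ∈ Θ | polyEval f p = 0}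

/-- Generic identifiability: `φ` is injective off a proper algebraic subset. -/
def GenId {α : Type} [Fintype α] [DecidableEq α] (D B : Set (α × α)) : Prop :=
  ∃ A, IsProperAlg (Theta D B) A ∧
    ∀ p ∈ Theta D B \ A, ∀ q ∈ Theta D B \ A, phi p = phi q → p = q

/-- Generic identifiability of the single coefficient `λ_{uv}`. -/
def GenIdLambda {α : Type} [Fintype α] [DecidableEq α] (D B : Set (α × α))
    (u v : α) : Prop :=
  ∃ A, IsProperAlg (Theta D B) A ∧
    ∀ p ∈ Theta D B \ A, ∀ q ∈ Theta D B \ A, phi p = phi q → p.1 u v = q.1 u v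

/-- Generic identifiability of the single coefficient `ω_{uv}`. -/
def GenIdOmega {α : Type} [Fintype α] [DecidableEq α] (D B : Set (α × α))
    (u v : α) : Prop :=
  ∃ A, IsProperAlg (Theta D B) A ∧
    ∀ p ∈ Theta D B \ A, ∀ q ∈ Theta D B \ A, phi p = phi q → p.2 u v = q.2 u v

/-- Generic identifiability of the coefficient vector `Λ_{pa(v), v}`. -/
def GenIdCol {α : Type} [Fintype α] [DecidableEq α] (D B : Set (α × α))
    (v : α) : Prop :=
  ∃ A, IsProperAlg (Theta D B) A ∧
    ∀ p ∈ Theta D B \ A, ∀ q ∈ Theta D B \ A, phi p = phi q →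
      ∀ u : α, (u, v) ∈ D → p.1 u v = q.1 u v

/-- The fiber of the parameter point `p` within `Θ`. -/
def fiber {α : Type} [Fintype α] [DecidableEq α] (D B : Set (α × α))
    (p : Matrix α α ℝ × Matrix α α ℝ) :
    Set (Matrix α α ℝ × Matrix α α ℝ) :=
  {q ∈ Theta D B | phi q = phi p}

/-- Generically infinite-to-one. -/
def GenInfToOne {α : Type} [Fintype α] [DecidableEq α] (D B : Set (α × α)) : Prop :=
  ∃ A, IsProperAlg (Theta D B) A ∧
    ∀ p ∈ Theta D B \ A, (fiber D B p).Infinite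

/-- Generically `h`-to-one: every fiber off a proper algebraic subset has exactly `h` points. -/
def GenHToOne {α : Type} [Fintype α] [DecidableEq α] (D B : Set (α × α))
    (h : ℕ) : Prop :=
  ∃ A, IsProperAlg (Theta D B) A ∧
    ∀ p ∈ Theta D B \ A, (fiber D B p).Finite ∧ (fiber D B p).ncard = h

/-- `w` lies in the connected component of `c` in the bidirected part `(V, B)`. -/
def bidirConn {n : ℕ} (B : Finset (Fin n × Fin n)) (c w : Fin n) : Prop :=
  Relation.ReflTransGen (fun a b => (a, b) ∈ B) c w

/-- The connected component `C` of `c` in the bidirected part. -/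
noncomputable def Cset {n : ℕ} (B : Finset (Fin n × Fin n)) (c : Fin n) :
    Finset (Fin n) :=
  Finset.univ.filter (bidirConn B c)

/-- The vertex set `V_i = C_i ∪ pa(C_i)` of the mixed component of `c`. -/
noncomputable def Vset {n : ℕ} (D B : Finset (Fin n × Fin n)) (c : Fin n) :
    Finset (Fin n) :=
  Cset B c ∪ Finset.univ.filter fun v => ∃ w ∈ Cset B c, (v, w) ∈ D

/-- The directed edges `D_i = {(v, w) ∈ D : v ∈ V_i, w ∈ C_i}` of the mixed component of `c`. -/
def compD {n : ℕ} (D B : Finset (Fin n × Fin n)) (c : Fin n) :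
    Set (↥(Vset D B c) × ↥(Vset D B c)) :=
  {e | ((e.1 : Fin n), (e.2 : Fin n)) ∈ D ∧ (e.2 : Fin n) ∈ Cset B c}

/-- The bidirected edges `B_i = {(v, w) ∈ B : v, w ∈ C_i}` of the mixed component of `c`. -/
def compB {n : ℕ} (D B : Finset (Fin n × Fin n)) (c : Fin n) :
    Set (↥(Vset D B c) × ↥(Vset D B c)) :=
  {e | ((e.1 : Fin n), (e.2 : Fin n)) ∈ B ∧ (e.1 : Fin n) ∈ Cset B c ∧
    (e.2 : Fin n) ∈ Cset B c}

/-- The edges of the induced subgraph `G_{V'}`, as pairs of vertices of the subtype `V'`. -/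
def inducedE {n : ℕ} (E : Finset (Fin n × Fin n)) (V' : Finset (Fin n)) :
    Set (↥V' × ↥V') :=
  {e | ((e.1 : Fin n), (e.2 : Fin n)) ∈ E}

/-- On a finite type a relation without cycles is well founded (towards its successors). -/
lemma hc_wf {α : Type} [Finite α] (r : α → α → Prop) (P : α → Prop)
    (h : ∀ a, ¬ P a → ¬ Relation.TransGen r a a) :
    WellFounded (fun b a : α => ¬ P b ∧ ¬ P a ∧ Relation.TransGen r a b) := by
  have : IsTrans α (fun b a : α => ¬ P b ∧ ¬ P a ∧ Relation.TransGen r a b) :=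
    ⟨fun a b c h1 h2 => ⟨h1.1, h2.2.1, h2.2.2.trans h1.2.2⟩⟩
  have : Std.Irrefl (fun b a : α => ¬ P b ∧ ¬ P a ∧ Relation.TransGen r a b) :=
    ⟨fun a h1 => h a h1.1 h1.2.2⟩
  exact Finite.wellFounded_of_trans_of_irrefl _

/-- For an acyclic graph `I - Λ` is invertible. -/
lemma hc_det_ne {n : ℕ} (D : Finset (Fin n × Fin n)) (hacyc : Acyclic D)
    (L : Matrix (Fin n) (Fin n) ℝ) (hL : ∀ a b, L a b ≠ 0 → (a, b) ∈ D) :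
    (1 - L).det ≠ 0 := by
  intro h0
  obtain ⟨x, hx, hx0⟩ := Matrix.exists_mulVec_eq_zero_iff.mpr h0
  apply hx
  have hwf := hc_wf (fun a b => (a, b) ∈ D) (fun _ => False) (fun a _ => hacyc a)
  funext a
  induction a using hwf.induction with
  | _ a ih =>
    have h1 := congrFun hx0 a
    rw [Matrix.sub_mulVec, Matrix.one_mulVec] at h1
    have h2 : (L *ᵥ x) a = 0 := by
      change ∑ b, L a b * x b = 0
      apply Finset.sum_eq_zero
      intro b _
      by_cases hb : L a b = 0
      · simp [hb]
      · rw [ih b ⟨id, id, Relation.TransGen.single (hL a b hb)⟩]; simp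
    simpa [h2] using h1

lemma hc_theta_convex {n : ℕ} (D B : Set (Fin n × Fin n))
    (p q : Matrix (Fin n) (Fin n) ℝ × Matrix (Fin n) (Fin n) ℝ)
    (hp : p ∈ Theta D B) (hq : q ∈ Theta D B) (t : ℝ) (h0 : 0 < t) (h1 : t < 1) :
    ((1 - t) • p + t • q) ∈ Theta D B := by
  obtain ⟨p1, p2, p3⟩ := hp
  obtain ⟨q1, q2, q3⟩ := hq
  refine ⟨?_, ?_, ?_⟩
  · intro a b h
    by_contra hc
    apply h
    have e1 : p.1 a b = 0 := by by_contra h'; exact hc (p1 a b h')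
    have e2 : q.1 a b = 0 := by by_contra h'; exact hc (q1 a b h')
    simp [e1, e2]
  · exact (p2.smul (by linarith : (0:ℝ) < 1 - t)).add (q2.smul h0)
  · intro a b hab h
    by_contra hc
    apply h
    have e1 : p.2 a b = 0 := by by_contra h'; exact hc (p3 a b hab h')
    have e2 : q.2 a b = 0 := by by_contra h'; exact hc (q3 a b hab h')
    simp [e1, e2]

/-- Restriction of a polynomial to a segment. -/
lemma hc_segment {n : ℕ} (f : MvPolynomial ((Fin n × Fin n) ⊕ (Fin n × Fin n)) ℝ)
    (p q : Matrix (Fin n) (Fin n) ℝ × Matrix (Fin n) (Fin n) ℝ) :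
    ∃ g : Polynomial ℝ, ∀ t : ℝ, g.eval t = polyEval f ((1 - t) • p + t • q) := by
  let pe : ((Fin n × Fin n) ⊕ (Fin n × Fin n)) → ℝ :=
    Sum.elim (fun e => p.1 e.1 e.2) (fun e => p.2 e.1 e.2)
  let qe : ((Fin n × Fin n) ⊕ (Fin n × Fin n)) → ℝ :=
    Sum.elim (fun e => q.1 e.1 e.2) (fun e => q.2 e.1 e.2)
  refine ⟨MvPolynomial.eval₂ Polynomial.C
    (fun i => (1 - Polynomial.X) * Polynomial.C (pe i) + Polynomial.X * Polynomial.C (qe i)) f, ?_⟩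
  intro t
  rw [← Polynomial.coe_evalRingHom, MvPolynomial.hom_eval₂]
  have : (Polynomial.evalRingHom t).comp Polynomial.C = RingHom.id ℝ := by
    ext; simp
  rw [this]
  unfold polyEval MvPolynomial.eval
  simp only [MvPolynomial.coe_eval₂Hom]
  congr 1
  funext i
  rcases i with i | i <;> (simp [pe, qe]; ring)

lemma hc_mul {n : ℕ} (D B : Set (Fin n × Fin n))
    (f g : MvPolynomial ((Fin n × Fin n) ⊕ (Fin n × Fin n)) ℝ)
    (hf : ∃ p ∈ Theta D B, polyEval f p ≠ 0) (hg : ∃ p ∈ Theta D B, polyEval g p ≠ 0) :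
    ∃ p ∈ Theta D B, polyEval (f * g) p ≠ 0 := by
  obtain ⟨p, hp, hfp⟩ := hf
  obtain ⟨q, hq, hgq⟩ := hg
  obtain ⟨F, hF⟩ := hc_segment f p q
  obtain ⟨G, hG⟩ := hc_segment g p q
  have hF0 : F ≠ 0 := by
    rintro rfl
    apply hfp
    have := hF 0
    simpa using this.symm
  have hG0 : G ≠ 0 := by
    rintro rfl
    apply hgq
    have := hG 1
    simpa using this.symm
  have hFG := mul_ne_zero hF0 hG0
  have hex : ∃ t ∈ Set.Ioo (0:ℝ) 1, (F * G).eval t ≠ 0 := by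
    by_contra hcon
    push Not at hcon
    apply hFG
    apply Polynomial.eq_zero_of_infinite_isRoot
    exact (Set.Ioo_infinite (by norm_num : (0:ℝ) < 1)).mono (fun t ht => hcon t ht)
  obtain ⟨t, ht, hne⟩ := hex
  refine ⟨_, hc_theta_convex D B p q hp hq t ht.1 ht.2, ?_⟩
  rw [Polynomial.eval_mul, hF, hG] at hne
  simpa [polyEval] using hne

lemma hc_posdef {n : ℕ} (M : Matrix (Fin n) (Fin n) ℝ) (hM : ∀ a b, M a b = M b a)
    (h0 : ∀ a b, 0 ≤ M a b) (h1 : ∀ a b, M a b ≤ 1) :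
    (((n : ℝ) + 1) • (1 : Matrix (Fin n) (Fin n) ℝ) + M).PosDef := by
  apply Matrix.PosDef.of_dotProduct_mulVec_pos
  · ext a b
    simp [Matrix.one_apply, hM a b, eq_comm]
  · intro x hx
    have hpos : 0 < ∑ a, x a ^ 2 := by
      obtain ⟨a, ha⟩ := Function.ne_iff.mp hx
      exact Finset.sum_pos' (fun _ _ => sq_nonneg _)
        ⟨a, Finset.mem_univ _, by simpa using (sq_pos_of_ne_zero ha)⟩
    have hq : star x ⬝ᵥ ((((n : ℝ) + 1) • (1 : Matrix (Fin n) (Fin n) ℝ) + M) *ᵥ x)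
        = ((n : ℝ) + 1) * ∑ a, x a ^ 2 + ∑ a, ∑ b, M a b * x a * x b := by
      rw [Matrix.add_mulVec, Matrix.smul_mulVec, Matrix.one_mulVec, dotProduct_add]
      congr 1
      · simp only [dotProduct, Finset.mul_sum]
        apply Finset.sum_congr rfl
        intro a _
        simp; ring
      · simp only [dotProduct, Matrix.mulVec, Finset.mul_sum]
        apply Finset.sum_congr rfl
        intro a _
        apply Finset.sum_congr rfl
        intro b _
        simp; ring
    rw [hq]
    have hb : ∀ a b, -((x a ^ 2 + x b ^ 2) / 2) ≤ M a b * x a * x b := by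
      intro a b
      nlinarith [h0 a b, h1 a b, mul_nonneg (h0 a b) (sq_nonneg (x a + x b)),
        mul_nonneg (sub_nonneg.mpr (h1 a b)) (add_nonneg (sq_nonneg (x a)) (sq_nonneg (x b)))]
    have hs : ∑ a : Fin n, ∑ b : Fin n, -((x a ^ 2 + x b ^ 2) / 2) ≤
        ∑ a, ∑ b, M a b * x a * x b :=
      Finset.sum_le_sum fun a _ => Finset.sum_le_sum fun b _ => hb a b
    have he : ∑ a : Fin n, ∑ b : Fin n, -((x a ^ 2 + x b ^ 2) / 2) = - (n : ℝ) * ∑ a, x a ^ 2 := by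
      simp only [Finset.sum_neg_distrib, ← Finset.sum_div, Finset.sum_add_distrib,
        Finset.sum_const, Finset.card_univ, Fintype.card_fin, nsmul_eq_mul, ← Finset.mul_sum]
      ring
    rw [he] at hs
    linarith

lemma hc_nodup {n : ℕ} (D : Finset (Fin n × Fin n)) (hacyc : Acyclic D) (l : List (Fin n))
    (hl : l.IsChain (fun a b => (a, b) ∈ D)) : l.Nodup := by
  have h1 : l.IsChain (Relation.TransGen (fun a b => (a, b) ∈ D)) :=
    hl.imp (fun a b h => Relation.TransGen.single h)
  rw [List.isChain_iff_pairwise] at h1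
  exact h1.imp (fun {a b} h e => by subst e; exact hacyc _ h)

/-- The linear system determining the path column. -/
lemma hc_path {n : ℕ} (Pa : Finset (Fin n)) (R : Fin n → List (Fin n))
    (hnd : ∀ p ∈ Pa, (R p).Nodup) (hlast : ∀ p ∈ Pa, (R p).getLast? = some p)
    (hdis : ∀ p ∈ Pa, ∀ q ∈ Pa, p ≠ q → ∀ x ∈ R p, x ∉ R q)
    (L : Matrix (Fin n) (Fin n) ℝ)
    (hL : L = fun a b => if ∃ q ∈ Pa, ∃ i, (R q)[i]? = some a ∧ (R q)[i+1]? = some b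
      then 1 else 0)
    (p : Fin n) (hp : p ∈ Pa) :
    (1 - L) *ᵥ (fun x => if x ∈ R p then (1:ℝ) else 0) = Pi.single p 1 := by
  have hpl : (R p)[(R p).length - 1]? = some p := by
    rw [← List.getLast?_eq_getElem?]; exact hlast p hp
  have hpm : p ∈ R p := List.mem_of_getElem? hpl
  have key : ∀ a b, (L a b * if b ∈ R p then (1:ℝ) else 0) =
      if ∃ i, (R p)[i]? = some a ∧ (R p)[i+1]? = some b then 1 else 0 := by
    intro a b
    subst hL
    by_cases h : ∃ i, (R p)[i]? = some a ∧ (R p)[i+1]? = some b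
    · have h' : ∃ q ∈ Pa, ∃ i, (R q)[i]? = some a ∧ (R q)[i+1]? = some b := ⟨p, hp, h⟩
      obtain ⟨i, _, hi⟩ := h
      have hb : b ∈ R p := List.mem_of_getElem? hi
      simp only [if_pos h', if_pos hb]
      rw [if_pos ⟨i, by assumption, hi⟩]; simp
    · rw [if_neg h]
      by_cases hb : b ∈ R p
      · have h' : ¬ ∃ q ∈ Pa, ∃ i, (R q)[i]? = some a ∧ (R q)[i+1]? = some b := by
          rintro ⟨q, hq, i, h1, h2⟩
          by_cases e : p = q
          · subst e; exact h ⟨i, h1, h2⟩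
          · exact hdis p hp q hq e b hb (List.mem_of_getElem? h2)
        simp only [if_neg h']; simp
      · simp [hb]
  funext a
  rw [Matrix.sub_mulVec, Matrix.one_mulVec, Pi.sub_apply]
  have hsum : (L *ᵥ (fun x => if x ∈ R p then (1:ℝ) else 0)) a =
      ∑ b, if ∃ i, (R p)[i]? = some a ∧ (R p)[i+1]? = some b then (1:ℝ) else 0 := by
    change ∑ b, (L a b * if b ∈ R p then (1:ℝ) else 0) = _
    exact Finset.sum_congr rfl fun b _ => key a b
  rw [hsum]
  have huniq : ∀ i j : ℕ, (R p)[i]? = some a → (R p)[j]? = some a → i = j := by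
    intro i j hi hj
    have hlt : i < (R p).length := by
      by_contra hc
      rw [List.getElem?_eq_none (by omega)] at hi
      cases hi
    exact (List.getElem?_inj hlt (hnd p hp)).mp (hi.trans hj.symm)
  by_cases ha : a ∈ R p
  · obtain ⟨i, hi⟩ := List.mem_iff_getElem?.mp ha
    by_cases hap : a = p
    · subst hap
      have : ∀ b, ¬ ∃ i, (R a)[i]? = some a ∧ (R a)[i+1]? = some b := by
        rintro b ⟨j, h1, h2⟩
        have := huniq _ _ h1 hpl
        subst this
        rw [List.getElem?_eq_none (by omega)] at h2
        cases h2
      simp [this, ha]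
    · have hlt : i + 1 < (R p).length := by
        by_contra hc
        have hlt : i < (R p).length := by
          by_contra hc
          rw [List.getElem?_eq_none (by omega)] at hi
          cases hi
        have : i = (R p).length - 1 := by omega
        subst this
        rw [hi] at hpl
        exact hap (Option.some.inj hpl)
      have hb : ∀ b, (∃ i, (R p)[i]? = some a ∧ (R p)[i+1]? = some b) ↔ (R p)[i+1] = b := by
        intro b
        constructor
        · rintro ⟨j, h1, h2⟩
          have := huniq _ _ h1 hi
          subst this
          rw [List.getElem?_eq_getElem hlt] at h2
          exact Option.some.inj h2
        · intro e
          exact ⟨i, hi, by rw [List.getElem?_eq_getElem hlt, e]⟩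
      simp [hb, ha, hap]
  · have : ∀ b, ¬ ∃ i, (R p)[i]? = some a ∧ (R p)[i+1]? = some b := by
      rintro b ⟨j, h1, h2⟩
      exact ha (List.mem_of_getElem? h1)
    have hap : a ≠ p := by rintro rfl; exact ha hpm
    simp [this, ha, hap]

/-- Existence of a parameter with nonsingular half-trek matrix. -/
lemma hc_exists {n : ℕ} (D B : Finset (Fin n × Fin n))
    (hG : IsMixedGraph D B) (hacyc : Acyclic D) (Pa : Finset (Fin n))
    (src : Fin n → Fin n) (R : Fin n → List (Fin n))
    (htrek : ∀ p ∈ Pa, IsTrek D B (src p) p [src p] (R p))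
    (hsrc : ∀ p ∈ Pa, ∀ q ∈ Pa, p ≠ q → src p ≠ src q)
    (hdis : ∀ p ∈ Pa, ∀ q ∈ Pa, p ≠ q → ∀ x ∈ R p, x ∉ R q) :
    ∃ p ∈ Theta (↑D : Set (Fin n × Fin n)) ↑B,
      (Matrix.of fun (a b : Pa) => (p.2 * (1 - p.1).adjugate) (src a) b).det ≠ 0 := by
  have hnd : ∀ p ∈ Pa, (R p).Nodup := fun p hp => hc_nodup D hacyc _ (htrek p hp).2.2.2.1
  have hlast : ∀ p ∈ Pa, (R p).getLast? = some p := fun p hp => (htrek p hp).2.2.2.2.2.1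
  have hinjS : ∀ p ∈ Pa, ∀ q ∈ Pa, src p = src q → p = q := by
    intro p hp q hq h; by_contra hc; exact hsrc p hp q hq hc h
  have hinjR : ∀ p ∈ Pa, ∀ q ∈ Pa, ∀ x, x ∈ R p → x ∈ R q → p = q := by
    intro p hp q hq x h1 h2; by_contra hc; exact hdis p hp q hq hc x h1 h2
  -- successor relation
  let S : Fin n → Fin n → Prop := fun q p => q ∈ Pa ∧ p ∈ Pa ∧ src q ∈ R p
  let P : Fin n → Prop := fun q => Relation.TransGen S q q
  let E : Fin n → Fin n → Prop := fun a b => ∃ q ∈ Pa, ¬ P q ∧ src q = a ∧ (R q).head? = some b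
  have hSfun : ∀ q p r, S q p → S q r → p = r := fun q p r h1 h2 =>
    hinjR p h1.2.1 r h2.2.1 _ h1.2.2 h2.2.2
  have hPsucc : ∀ q p, P q → S q p → P p := by
    intro q p hq hqp
    obtain ⟨r, hqr, hrq⟩ := Relation.TransGen.head'_iff.mp hq
    have := hSfun q p r hqp hqr
    subst this
    exact Relation.TransGen.tail' hrq hqp
  have hPpred : ∀ p, P p → ∃ q, P q ∧ S q p := by
    intro p hp
    obtain ⟨q, hpq, hqp⟩ := Relation.TransGen.tail'_iff.mp hp
    exact ⟨q, Relation.TransGen.head' hqp hpq, hqp⟩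
  have hEB : ∀ a b, E a b → (a, b) ∈ B := by
    rintro a b ⟨q, hq, hPq, rfl, hb⟩
    rcases (htrek q hq).2.2.2.2.2.2 with h | ⟨u, z, h1, h2, h3⟩
    · exfalso
      apply hPq
      have : src q ∈ R q := by
        apply List.mem_of_mem_head?
        rw [← h]; simp
      exact Relation.TransGen.single ⟨hq, hq, this⟩
    · rw [hb] at h2
      simp at h1 h2
      subst h1 h2
      exact h3
  let M : Matrix (Fin n) (Fin n) ℝ := fun a b => if E a b ∨ E b a then 1 else 0
  let Om : Matrix (Fin n) (Fin n) ℝ := ((n : ℝ) + 1) • (1 : Matrix (Fin n) (Fin n) ℝ) + M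
  let L : Matrix (Fin n) (Fin n) ℝ :=
    fun a b => if ∃ q ∈ Pa, ∃ i, (R q)[i]? = some a ∧ (R q)[i+1]? = some b then 1 else 0
  have hM0 : ∀ a b, 0 ≤ M a b := by
    intro a b; simp only [M]; split_ifs <;> norm_num
  have hOm0 : ∀ a b, 0 ≤ Om a b := by
    intro a b
    have := hM0 a b
    simp only [Om, Matrix.add_apply, Matrix.smul_apply, Matrix.one_apply]
    split_ifs <;> simp <;> positivity
  have hOmdiag : ∀ a, 0 < Om a a := by
    intro a
    have := hM0 a a
    simp only [Om, Matrix.add_apply, Matrix.smul_apply, Matrix.one_apply]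
    simp; positivity
  have hOmE : ∀ a b, E a b → 0 < Om a b := by
    intro a b h
    have h1 : M a b = 1 := by simp [M, h]
    simp only [Om, Matrix.add_apply, Matrix.smul_apply, Matrix.one_apply, h1]
    split_ifs <;> simp <;> positivity
  have hOmne : ∀ a b, Om a b ≠ 0 → a = b ∨ E a b ∨ E b a := by
    intro a b h
    by_contra hc
    push Not at hc
    apply h
    have h1 : M a b = 0 := by simp [M, hc]
    simp [Om, Matrix.add_apply, h1, hc.1]
  have hLD : ∀ a b, L a b ≠ 0 → (a, b) ∈ D := by
    intro a b h
    have : ∃ q ∈ Pa, ∃ i, (R q)[i]? = some a ∧ (R q)[i+1]? = some b := by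
      by_contra hc
      exact h (by simp only [L]; rw [if_neg hc])
    obtain ⟨q, hq, i, h1, h2⟩ := this
    have hch := (htrek q hq).2.2.2.1
    obtain ⟨hi, h1⟩ := List.getElem?_eq_some_iff.mp h1
    obtain ⟨hi', h2⟩ := List.getElem?_eq_some_iff.mp h2
    have := List.isChain_iff_getElem.mp hch i hi'
    rw [h1, h2] at this
    exact this
  refine ⟨(L, Om), ⟨fun a b h => hLD a b h, ?_, ?_⟩, ?_⟩
  · apply hc_posdef M _ hM0
    · intro a b; simp only [M]; split_ifs <;> norm_num
    · intro a b; simp only [M, or_comm]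
  · intro a b hab h
    rcases hOmne a b h with h | h | h
    · exact absurd h hab
    · exact hEB a b h
    · exact hG.1 _ _ (hEB b a h)
  · have hdet := hc_det_ne D hacyc L hLD
    have hadj : ∀ p ∈ Pa, ∀ x, (1 - L).adjugate x p = (1 - L).det * if x ∈ R p then 1 else 0 := by
      intro p hp x
      have h1 := hc_path Pa R hnd hlast hdis L rfl p hp
      have h2 := congrArg (fun w => ((1 - L).adjugate *ᵥ w) x) h1
      simp only [Matrix.mulVec_mulVec, Matrix.adjugate_mul, Matrix.smul_mulVec,
        Matrix.one_mulVec, Matrix.mulVec_single_one] at h2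
      simpa using h2.symm
    have hA : ∀ q : Fin n, ∀ p ∈ Pa, (Om * (1 - L).adjugate) (src q) p =
        (1 - L).det * ∑ x, if x ∈ R p then Om (src q) x else 0 := by
      intro q p hp
      rw [Matrix.mul_apply, Finset.mul_sum]
      apply Finset.sum_congr rfl
      intro x _
      rw [hadj p hp]
      split_ifs <;> ring
    intro h0
    obtain ⟨y, hy, hy0⟩ := Matrix.exists_mulVec_eq_zero_iff.mpr h0
    apply hy
    -- entries
    let T : Fin n → Fin n → ℝ := fun q p => ∑ x, if x ∈ R p then Om (src q) x else 0
    have hTpos : ∀ q p x, x ∈ R p → 0 < Om (src q) x → 0 < T q p := by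
      intro q p x hx hpos
      refine Finset.sum_pos' (fun z _ => ?_) ⟨x, Finset.mem_univ _, by simpa [hx] using hpos⟩
      split_ifs
      · exact hOm0 _ _
      · exact le_rfl
    have hTne : ∀ q p, T q p ≠ 0 → ∃ x ∈ R p, src q = x ∨ E (src q) x ∨ E x (src q) := by
      intro q p h
      obtain ⟨x, _, hx⟩ := Finset.exists_ne_zero_of_sum_ne_zero h
      by_cases hxp : x ∈ R p
      · rw [if_pos hxp] at hx
        exact ⟨x, hxp, hOmne _ _ hx⟩
      · rw [if_neg hxp] at hx; exact absurd rfl hx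
    have hrow : ∀ q : Pa, ∑ p : Pa, T q p * y p = 0 := by
      intro q
      have h1 := congrFun hy0 q
      simp only [Matrix.mulVec, dotProduct, Matrix.of_apply, Pi.zero_apply] at h1
      have h2 : (1 - L).det * ∑ p : Pa, T q p * y p = 0 := by
        rw [← h1, Finset.mul_sum]
        apply Finset.sum_congr rfl
        intro p _
        rw [hA q p p.2]; ring
      exact (mul_eq_zero.mp h2).resolve_left hdet
    have hsolve : ∀ q p : Pa, 0 < T q p → (∀ r : Pa, r ≠ p → T q r * y r = 0) → y p = 0 := by
      intro q p hT hr
      have h1 := hrow q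
      rw [Finset.sum_eq_single p (fun r _ h => hr r h) (by simp)] at h1
      exact (mul_eq_zero.mp h1).resolve_left hT.ne'
    have hz : ∀ r ∈ Pa, ∀ x, (R r).head? = some x → x ∈ R r := fun r _ x h =>
      List.mem_of_mem_head? (by simpa using h)
    have hyP : ∀ p : Pa, P p → y p = 0 := by
      intro p hp
      obtain ⟨q, hPq, hqp⟩ := hPpred p hp
      refine hsolve ⟨q, hqp.1⟩ p (hTpos _ _ (src q) hqp.2.2 (hOmdiag _)) ?_
      intro r hrp
      by_contra hne
      obtain ⟨x, hx, h⟩ := hTne _ _ (left_ne_zero_of_mul hne)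
      rcases h with h | ⟨s, hs, hPs, h1, h2⟩ | ⟨s, hs, hPs, h1, h2⟩
      · subst h
        exact hrp (Subtype.ext (hSfun q r p ⟨hqp.1, r.2, hx⟩ hqp))
      · exact hPs (by rw [hinjS s hs q hqp.1 h1]; exact hPq)
      · exact hPs (hPsucc q s hPq ⟨hqp.1, hs, hz s hs _ h2⟩)
    have hwf := hc_wf S P (fun a h => h)
    have hall : ∀ a : Fin n, ∀ ha : a ∈ Pa, y ⟨a, ha⟩ = 0 := by
      intro a
      induction a using hwf.induction with
      | _ q ih =>
        intro hq
        by_cases hPq : P q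
        · exact hyP ⟨q, hq⟩ hPq
        have ih' : ∀ p : Pa, Relation.TransGen S q p → y p = 0 := by
          intro p h
          by_cases hPp : P p
          · exact hyP p hPp
          · exact ih p ⟨hPp, hPq, h⟩ p.2
        have hRne := (htrek q hq).2.1
        have hhead : (R q).head? = some ((R q).head hRne) := List.head?_eq_some_head hRne
        refine hsolve ⟨q, hq⟩ ⟨q, hq⟩ (hTpos _ _ ((R q).head hRne) (List.head_mem hRne)
          (hOmE _ _ ⟨q, hq, hPq, rfl, hhead⟩)) ?_
        intro r hrq
        by_contra hne
        obtain ⟨x, hx, h⟩ := hTne _ _ (left_ne_zero_of_mul hne)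
        apply right_ne_zero_of_mul hne
        rcases h with h | ⟨s, hs, hPs, h1, h2⟩ | ⟨s, hs, hPs, h1, h2⟩
        · subst h
          exact ih' r (Relation.TransGen.single ⟨hq, r.2, hx⟩)
        · have := hinjS s hs q hq h1
          subst this
          exact absurd (Subtype.ext (hinjR r r.2 s hs x hx (hz s hs x h2))) hrq
        · subst h1
          have hS1 : S q s := ⟨hq, hs, hz s hs _ h2⟩
          have hS2 : S s r := ⟨hs, r.2, hx⟩
          exact ih' r (Relation.TransGen.tail (Relation.TransGen.single hS1) hS2)
    funext a
    exact hall a a.2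

/-- The polynomial whose value is the half-trek determinant. -/
lemma hc_poly {n : ℕ} (Pa : Finset (Fin n)) (src : Fin n → Fin n) :
    ∃ f : MvPolynomial ((Fin n × Fin n) ⊕ (Fin n × Fin n)) ℝ, ∀ p,
      polyEval f p =
        (Matrix.of fun (a b : Pa) => (p.2 * (1 - p.1).adjugate) (src a) b).det := by
  let XL : Matrix (Fin n) (Fin n) (MvPolynomial ((Fin n × Fin n) ⊕ (Fin n × Fin n)) ℝ) :=
    Matrix.of fun a b => MvPolynomial.X (Sum.inl (a, b))
  let XO : Matrix (Fin n) (Fin n) (MvPolynomial ((Fin n × Fin n) ⊕ (Fin n × Fin n)) ℝ) :=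
    Matrix.of fun a b => MvPolynomial.X (Sum.inr (a, b))
  refine ⟨(Matrix.of fun (a b : Pa) => (XO * (1 - XL).adjugate) (src a) b).det, ?_⟩
  intro p
  unfold polyEval
  rw [RingHom.map_det]
  congr 1
  set φ := MvPolynomial.eval (Sum.elim (fun e : Fin n × Fin n => p.1 e.1 e.2)
    (fun e : Fin n × Fin n => p.2 e.1 e.2)) with hφ
  have hL : φ.mapMatrix XL = p.1 := by
    ext a b; simp [XL, hφ]
  have hO : φ.mapMatrix XO = p.2 := by
    ext a b; simp [XO, hφ]
  have h : φ.mapMatrix (XO * (1 - XL).adjugate) = p.2 * (1 - p.1).adjugate := by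
    rw [map_mul, RingHom.map_adjugate, map_sub, map_one, hL, hO]
  ext a b
  exact congrFun (congrFun h (src a)) b

theorem stmt7 (n : ℕ) (D B : Finset (Fin n × Fin n))
    (hG : IsMixedGraph D B) (hacyc : Acyclic D)
    (v : Fin n) (Y : Finset (Fin n)) (hY : SatisfiesHTC D B v Y)
    (hid : ∀ y ∈ Y, GenIdCol (↑D : Set (Fin n × Fin n)) ↑B y) :
    GenIdCol (↑D : Set (Fin n × Fin n)) ↑B v := by
  obtain ⟨_, hYv, src, R, hR, hsys⟩ := hY
  have hid' : ∀ y : Fin n, ∃ f : MvPolynomial ((Fin n × Fin n) ⊕ (Fin n × Fin n)) ℝ,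
      (∃ p ∈ Theta (↑D : Set (Fin n × Fin n)) ↑B, polyEval f p ≠ 0) ∧ (y ∈ Y →
      ∀ p ∈ Theta (↑D : Set (Fin n × Fin n)) ↑B, polyEval f p ≠ 0 →
      ∀ q ∈ Theta (↑D : Set (Fin n × Fin n)) ↑B, polyEval f q ≠ 0 → phi p = phi q →
      ∀ u : Fin n, (u, y) ∈ D → p.1 u y = q.1 u y) := by
    intro y
    by_cases hy : y ∈ Y
    · obtain ⟨A, ⟨f, hf, rfl⟩, h⟩ := hid y hy
      refine ⟨f, hf, fun _ p hp hfp q hq hfq e u hu => ?_⟩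
      exact h p ⟨hp, fun h => hfp h.2⟩ q ⟨hq, fun h => hfq h.2⟩ e u (by simpa using hu)
    · refine ⟨1, ⟨(0, 1), ⟨by simp, Matrix.PosDef.one, ?_⟩, by simp [polyEval]⟩,
        fun h => absurd h hy⟩
      intro a b hab h
      exact absurd (Matrix.one_apply_ne hab) h
  choose f hf0 hf using hid'
  obtain ⟨g, hg⟩ := hc_poly (paF D v) src
  have hg0 : ∃ p ∈ Theta (↑D : Set (Fin n × Fin n)) ↑B, polyEval g p ≠ 0 := by
    simp only [hg]
    exact hc_exists D B hG hacyc (paF D v) src R (fun p hp => (hR p hp).2)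
      (fun p hp q hq h => (hsys p hp q hq h).1) (fun p hp q hq h => (hsys p hp q hq h).2)
  have hprod : ∀ s : Finset (Fin n),
      ∃ p ∈ Theta (↑D : Set (Fin n × Fin n)) ↑B, polyEval (g * ∏ y ∈ s, f y) p ≠ 0 := by
    intro s
    induction s using Finset.induction_on with
    | empty => simpa using hg0
    | insert a s ha ih =>
      rw [Finset.prod_insert ha, mul_left_comm]
      exact hc_mul _ _ _ _ (hf0 a) ih
  refine ⟨_, ⟨g * ∏ y ∈ Y, f y, hprod Y, rfl⟩, ?_⟩
  rintro p ⟨hp, hpA⟩ q ⟨hq, hqA⟩ hpq u hu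
  have hsplit : ∀ p ∈ Theta (↑D : Set (Fin n × Fin n)) ↑B,
      p ∉ {p ∈ Theta (↑D : Set (Fin n × Fin n)) ↑B | polyEval (g * ∏ y ∈ Y, f y) p = 0} →
      polyEval g p ≠ 0 ∧ ∀ y ∈ Y, polyEval (f y) p ≠ 0 := by
    intro p hp h
    have h1 : polyEval (g * ∏ y ∈ Y, f y) p ≠ 0 := fun h' => h ⟨hp, h'⟩
    simp only [polyEval, map_mul, map_prod] at h1
    exact ⟨left_ne_zero_of_mul h1, Finset.prod_ne_zero_iff.mp (right_ne_zero_of_mul h1)⟩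
  obtain ⟨hpg, hpf⟩ := hsplit p hp hpA
  obtain ⟨hqg, hqf⟩ := hsplit q hq hqA
  have hcol : ∀ y ∈ Y, ∀ a, p.1 a y = q.1 a y := by
    intro y hy a
    by_cases ha : (a, y) ∈ D
    · exact hf y hy p hp (hpf y hy) q hq (hqf y hy) hpq a ha
    · have e1 : p.1 a y = 0 := by by_contra h'; exact ha (by simpa using hp.1 a y h')
      have e2 : q.1 a y = 0 := by by_contra h'; exact ha (by simpa using hq.1 a y h')
      rw [e1, e2]
  have hdp : (1 - p.1).det ≠ 0 := hc_det_ne D hacyc p.1 (fun a b h => by simpa using hp.1 a b h)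
  have hdq : (1 - q.1).det ≠ 0 := hc_det_ne D hacyc q.1 (fun a b h => by simpa using hq.1 a b h)
  have hW : ∀ p : Matrix (Fin n) (Fin n) ℝ × Matrix (Fin n) (Fin n) ℝ, (1 - p.1).det ≠ 0 →
      (1 - p.1)ᵀ * phi p = p.2 * (1 - p.1)⁻¹ ∧ (1 - p.1)ᵀ * phi p * (1 - p.1) = p.2 := by
    intro p hd
    have hu : IsUnit (1 - p.1).det := isUnit_iff_ne_zero.mpr hd
    have h1 : (1 - p.1)ᵀ * phi p = p.2 * (1 - p.1)⁻¹ := by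
      unfold phi
      rw [← Matrix.mul_assoc, ← Matrix.mul_assoc, ← Matrix.transpose_mul,
        Matrix.nonsing_inv_mul _ hu, Matrix.transpose_one, Matrix.one_mul]
    refine ⟨h1, ?_⟩
    rw [h1, Matrix.mul_assoc, Matrix.nonsing_inv_mul _ hu, Matrix.mul_one]
  obtain ⟨hp1, hp2⟩ := hW p hdp
  obtain ⟨hq1, hq2⟩ := hW q hdq
  have hWeq : ∀ y ∈ Y, ∀ c, ((1 - p.1)ᵀ * phi p : Matrix (Fin n) (Fin n) ℝ) y c =
      ((1 - q.1)ᵀ * phi q : Matrix (Fin n) (Fin n) ℝ) y c := by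
    intro y hy c
    rw [hpq, Matrix.mul_apply, Matrix.mul_apply]
    apply Finset.sum_congr rfl
    intro a _
    simp only [Matrix.transpose_apply, Matrix.sub_apply, hcol y hy a]
  have hzero : ∀ p ∈ Theta (↑D : Set (Fin n × Fin n)) ↑B, ∀ y ∈ Y, p.2 y v = 0 := by
    intro p hp y hy
    by_contra h
    exact (hYv y hy).2 (by simpa using hp.2.2 y v (hYv y hy).1 h)
  have hker : ∀ y ∈ Y, ∑ c, ((1 - p.1)ᵀ * phi p : Matrix (Fin n) (Fin n) ℝ) y c * (p.1 c v - q.1 c v) = 0 := by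
    intro y hy
    have h1 := congrFun (congrFun hp2 y) v
    have h2 := congrFun (congrFun hq2 y) v
    rw [hzero p hp y hy, Matrix.mul_apply] at h1
    rw [hzero q hq y hy, Matrix.mul_apply] at h2
    simp only [← hWeq y hy] at h2
    rw [← sub_eq_zero.mpr (h2.trans h1.symm), ← Finset.sum_sub_distrib]
    apply Finset.sum_congr rfl
    intro c _
    simp only [Matrix.sub_apply]; ring
  rw [hg] at hpg
  have hx := Matrix.eq_zero_of_mulVec_eq_zero (v := fun c : paF D v => p.1 c v - q.1 c v) hpg ?_
  · have := congrFun hx ⟨u, by simpa [paF] using hu⟩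
    exact sub_eq_zero.mp this
  · funext a
    have hk := hker (src a) (hR a a.2).1
    rw [hp1] at hk
    have hadj : (1 - p.1).adjugate = (1 - p.1).det • (1 - p.1)⁻¹ := by
      rw [Matrix.inv_def, smul_smul, Ring.mul_inverse_cancel _ (isUnit_iff_ne_zero.mpr hdp),
        one_smul]
    simp only [Matrix.mulVec, dotProduct, Matrix.of_apply, Pi.zero_apply]
    rw [hadj, Matrix.mul_smul]
    simp only [Matrix.smul_apply, smul_eq_mul, mul_assoc]
    rw [← Finset.mul_sum]
    have : ∑ c : paF D v, (p.2 * (1 - p.1)⁻¹) (src a) c * (p.1 c v - q.1 c v) =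
        ∑ c, (p.2 * (1 - p.1)⁻¹) (src a) c * (p.1 c v - q.1 c v) := by
      rw [Finset.sum_coe_sort (paF D v)
        (fun c => (p.2 * (1 - p.1)⁻¹) (src a) c * (p.1 c v - q.1 c v))]
      apply Finset.sum_subset (Finset.subset_univ _)
      intro c _ hc
      have ha : (c, v) ∉ D := by simpa [paF] using hc
      have e1 : p.1 c v = 0 := by by_contra h'; exact ha (by simpa using hp.1 c v h')
      have e2 : q.1 c v = 0 := by by_contra h'; exact ha (by simpa using hq.1 c v h')
      simp [e1, e2]
    rw [this, hk, mul_zero]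
end

section
/- Let G = (V,D,B) be an acyclic mixed graph. Suppose (Y_v : v ∈ V) is a family of subsets of V such that for each v ∈ V the set Y_v satisfies the half-trek criterion with respect to v, and suppose there is a total order ≺ on V such that w ≺ v whenever w ∈ Y_v ∩ htr(v). Then G is generically identifiable: there is a proper algebraic subset A ⊂ Θ_G such that the parameterization map φ_G is injective on Θ_G ∖ A. -/
open scoped Classical Matrix

/-- A system of half-treks without sided intersection, indexed by `ι`. -/
def HSys {n : ℕ} {ι : Type} (D B : Finset (Fin n × Fin n)) (t : ι → Fin n)
    (Y : Finset (Fin n)) (y : ι → Fin n) (R : ι → List (Fin n)) : Prop :=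
  Function.Injective y ∧ (∀ i, y i ∈ Y ∧ IsTrek D B (y i) (t i) [y i] (R i)) ∧
    ∀ i j, i ≠ j → ∀ x ∈ R i, x ∉ R j

noncomputable def hcost {n : ℕ} {ι : Type} [Fintype ι] (y : ι → Fin n)
    (R : ι → List (Fin n)) : ℕ :=
  ∑ i, ((R i).length + if (R i).head? = some (y i) then 0 else 1)

theorem exists_suffix_of_mem {α : Type} (x : α) (l : List α) (h : x ∈ l) :
    ∃ l', l' <:+ l ∧ l'.head? = some x := by
  obtain ⟨a, b, rfl⟩ := List.append_of_mem h
  exact ⟨x :: b, List.suffix_append _ _, rfl⟩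

theorem reroute {n : ℕ} {ι : Type} [Fintype ι] (D B : Finset (Fin n × Fin n)) (t : ι → Fin n)
    (Y : Finset (Fin n)) (y : ι → Fin n) (R : ι → List (Fin n)) (h : HSys D B t Y y R)
    (hmin : ∀ y' R', HSys D B t Y y' R' → hcost y R ≤ hcost y' R')
    (s : ι → ι) (hs : ∀ q, y q ∈ R (s q) ∨ s q = q)
    (q : ι) (hq : q ∈ Function.periodicPts s) :
    s q = q ∧ (y q ∈ R q → (R q).head? = some (y q)) := by
  obtain ⟨hinj, htr, hdis⟩ := h
  let e : ι → ι := fun q => if q ∈ Function.periodicPts s then s q else q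
  have heb : Function.Bijective e := by
    rw [← Finite.injective_iff_bijective]
    have hb := Function.bijOn_periodicPts (f := s)
    intro a b hab
    simp only [e] at hab
    by_cases ha : a ∈ Function.periodicPts s <;> by_cases hb' : b ∈ Function.periodicPts s
    · simp only [ha, hb', if_true] at hab
      exact hb.injOn ha hb' hab
    · simp only [ha, hb', if_true, if_false] at hab
      exact absurd (hab ▸ hb.mapsTo ha) hb'
    · simp only [ha, hb', if_true, if_false] at hab
      exact absurd (hab ▸ hb.mapsTo hb') ha
    · simpa only [ha, hb', if_false] using hab
  let E := Equiv.ofBijective e heb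
  have he : ∀ q, y q ∈ R (e q) ∨ e q = q := by
    intro q
    simp only [e]
    split_ifs
    · exact hs q
    · right; rfl
  have he' : ∀ p, y (E.symm p) ∈ R p ∨ E.symm p = p := by
    intro p
    have h1 : e (E.symm p) = p := E.apply_symm_apply p
    rcases he (E.symm p) with h | h
    · left; rwa [h1] at h
    · right; rw [← h, h1]
  have hR' : ∀ p, ∃ l, l <:+ R p ∧ (y (E.symm p) ∈ R p → l.head? = some (y (E.symm p))) ∧
      (y (E.symm p) ∉ R p → l = R p) := by
    intro p
    by_cases hm : y (E.symm p) ∈ R p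
    · obtain ⟨l, hl, hl'⟩ := exists_suffix_of_mem _ _ hm
      exact ⟨l, hl, fun _ => hl', fun h => absurd hm h⟩
    · exact ⟨R p, List.suffix_refl _, fun h => absurd h hm, fun _ => rfl⟩
  choose R' hsuf hhead heq using hR'
  have hsys : HSys D B t Y (fun p => y (E.symm p)) R' := by
    refine ⟨hinj.comp E.symm.injective, ?_, ?_⟩
    · intro p
      refine ⟨(htr _).1, ?_⟩
      by_cases hm : y (E.symm p) ∈ R p
      · obtain ⟨-, h2, h3, h4, h5, h6, h7⟩ := (htr p).2
        have hh := hhead p hm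
        have hne : R' p ≠ [] := by intro h0; rw [h0] at hh; simp at hh
        refine ⟨by simp, hne, List.isChain_singleton _, ?_, by simp, ?_, ?_⟩
        · exact List.IsChain.suffix h4 (hsuf p)
        · obtain ⟨a, ha⟩ := hsuf p
          rw [← ha, List.getLast?_append_of_ne_nil _ hne] at h6
          exact h6
        · left; rw [hh]; rfl
      · rw [heq p hm]
        have : E.symm p = p := (he' p).resolve_left hm
        beta_reduce
        rw [this]
        exact (htr p).2
    · intro i j hij x hx hx'
      exact hdis i j hij x ((hsuf i).subset hx) ((hsuf j).subset hx')
  have hle : ∀ p, (R' p).length + (if (R' p).head? = some (y (E.symm p)) then 0 else 1) ≤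
      (R p).length + (if (R p).head? = some (y p) then 0 else 1) := by
    intro p
    by_cases hm : y (E.symm p) ∈ R p
    · rw [if_pos (hhead p hm)]
      exact le_add_right (hsuf p).length_le
    · rw [heq p hm, (he' p).resolve_left hm]
  have hall := (Finset.sum_eq_sum_iff_of_le (fun p _ => hle p)).1
    (le_antisymm (Finset.sum_le_sum fun p _ => hle p) (hmin _ _ hsys))
  have key : ∀ p, y (E.symm p) ∈ R p → (R p).head? = some (y p) ∧ E.symm p = p := by
    intro p hm
    have h1 := hall p (Finset.mem_univ _)
    rw [if_pos (hhead p hm)] at h1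
    have h2 := (hsuf p).length_le
    have h3 : (R p).head? = some (y p) := by
      by_contra hc
      rw [if_neg hc] at h1
      omega
    rw [if_pos h3] at h1
    have h4 : R' p = R p := (hsuf p).eq_of_length (by omega)
    have h5 := hhead p hm
    rw [h4, h3] at h5
    exact ⟨h3, (hinj (Option.some.inj h5)).symm⟩
  have hEq : E q = s q := by
    change e q = s q
    simp only [e, if_pos hq]
  have hfix : s q = q := by
    rcases hs q with h | h
    · have := key (s q) (by rw [← hEq, E.symm_apply_apply, hEq]; exact h)
      have h2 := this.2
      rw [← hEq, E.symm_apply_apply] at h2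
      rw [← hEq]; exact h2.symm
    · exact h
  refine ⟨hfix, fun hm => ?_⟩
  have h2 : E.symm q = q := by
    rw [Equiv.symm_apply_eq, hEq, hfix]
  exact (key q (by rw [h2]; exact hm)).1

theorem exists_rank {ι : Type} [Finite ι] (s : ι → ι)
    (hs : ∀ q ∈ Function.periodicPts s, s q = q) :
    ∃ d : ι → ℕ, ∀ q, d (s q) ≤ d q ∧ (s q ≠ q → d (s q) < d q) := by
  have hex : ∀ q, ∃ k, s (s^[k] q) = s^[k] q := by
    intro q
    obtain ⟨i, j, hij, h⟩ := Finite.exists_ne_map_eq_of_infinite (fun k : ℕ => s^[k] q)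
    wlog hlt : i < j generalizing i j
    · exact this j i hij.symm h.symm (by omega)
    refine ⟨i, hs _ (Function.mk_mem_periodicPts (n := j - i) (by omega) ?_)⟩
    replace h : s^[i] q = s^[j] q := h
    rw [Function.IsPeriodicPt, Function.IsFixedPt, ← Function.iterate_add_apply, h]
    congr 2; omega
  refine ⟨fun q => Nat.find (hex q), fun q => ?_⟩
  have hlt : s q ≠ q → Nat.find (hex (s q)) < Nat.find (hex q) := by
    intro hne
    have h1 := Nat.find_spec (hex q)
    obtain ⟨k, hk⟩ : ∃ k, Nat.find (hex q) = k + 1 := by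
      cases h : Nat.find (hex q) with
      | zero => rw [h] at h1; exact absurd h1 hne
      | succ k => exact ⟨k, rfl⟩
    rw [hk, Function.iterate_succ_apply] at h1
    have := Nat.find_min' (hex (s q)) h1
    omega
  refine ⟨?_, hlt⟩
  by_cases hne : s q = q
  · simp only [hne]; exact le_refl _
  · exact (hlt hne).le

theorem det_ne_zero_of_tri {ι α : Type} [Fintype ι] [DecidableEq ι] [LinearOrder α]
    [WellFoundedLT α] (M : Matrix ι ι ℝ) (b : ι → α) (hd : ∀ i, M i i ≠ 0)
    (h : ∀ i j, M i j ≠ 0 → i = j ∨ b j < b i) : M.det ≠ 0 := by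
  intro h0
  obtain ⟨x, hx, hMx⟩ := Matrix.exists_mulVec_eq_zero_iff.2 h0
  apply hx
  have : ∀ a : α, ∀ i, b i = a → x i = 0 := by
    intro a
    induction a using WellFoundedLT.induction with
    | ind a ih =>
      intro i hi
      have h1 := congrFun hMx i
      simp only [Matrix.mulVec, dotProduct, Pi.zero_apply] at h1
      rw [Finset.sum_eq_single i] at h1
      · exact (mul_eq_zero.1 h1).resolve_left (hd i)
      · intro j _ hj
        by_cases hM : M i j = 0
        · rw [hM, zero_mul]
        · rcases h i j hM with h | h
          · exact absurd h.symm hj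
          · rw [ih (b j) (hi ▸ h) j rfl, mul_zero]
      · simp
  funext i
  exact this _ i rfl

theorem exists_topo {n : ℕ} (D : Finset (Fin n × Fin n)) (hacyc : Acyclic D) :
    ∃ τ : Fin n → ℕ, (∀ a, τ a ≤ n) ∧ ∀ a b, (a, b) ∈ D → τ a < τ b := by
  refine ⟨fun b => (Finset.univ.filter fun a =>
    Relation.TransGen (fun a b => (a, b) ∈ D) a b).card, fun a => ?_, fun a b hab => ?_⟩
  · exact (Finset.card_filter_le _ _).trans (by simp)
  · apply Finset.card_lt_card
    rw [Finset.ssubset_iff_of_subset]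
    · exact ⟨a, by simpa using Relation.TransGen.single hab, by simpa using hacyc a⟩
    · intro c hc
      simp only [Finset.mem_filter, Finset.mem_univ, true_and] at hc ⊢
      exact hc.tail hab


noncomputable def Nmat {n : ℕ} (Λ : Matrix (Fin n) (Fin n) ℝ) : Matrix (Fin n) (Fin n) ℝ :=
  ∑ k ∈ Finset.range (n + 1), Λ ^ k

theorem exists_of_mul_ne_zero {ι κ l : Type} [Fintype κ] (A : Matrix ι κ ℝ) (B : Matrix κ l ℝ)
    (a : ι) (b : l) (h : (A * B) a b ≠ 0) : ∃ c, A a c ≠ 0 ∧ B c b ≠ 0 := by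
  rw [Matrix.mul_apply] at h
  obtain ⟨c, -, hc⟩ := Finset.exists_ne_zero_of_sum_ne_zero h
  exact ⟨c, left_ne_zero_of_mul hc, right_ne_zero_of_mul hc⟩

theorem pow_tau {n : ℕ} (Λ : Matrix (Fin n) (Fin n) ℝ) (τ : Fin n → ℕ)
    (h : ∀ a b, Λ a b ≠ 0 → τ a < τ b) (k : ℕ) :
    ∀ a b, (Λ ^ k) a b ≠ 0 → τ a + k ≤ τ b := by
  induction k with
  | zero =>
    intro a b hab
    rw [pow_zero, Matrix.one_apply] at hab
    have : a = b := by by_contra hc; simp [hc] at hab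
    simp [this]
  | succ k ih =>
    intro a b hab
    rw [pow_succ] at hab
    obtain ⟨c, h1, h2⟩ := exists_of_mul_ne_zero _ _ _ _ hab
    have := ih _ _ h1
    have := h _ _ h2
    omega

theorem pow_rtg {n : ℕ} (Λ : Matrix (Fin n) (Fin n) ℝ) (E : Fin n → Fin n → Prop)
    (h : ∀ a b, Λ a b ≠ 0 → E a b) (k : ℕ) :
    ∀ a b, (Λ ^ k) a b ≠ 0 → Relation.ReflTransGen E a b := by
  induction k with
  | zero =>
    intro a b hab
    rw [pow_zero, Matrix.one_apply] at hab
    have : a = b := by by_contra hc; simp [hc] at hab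
    rw [this]
  | succ k ih =>
    intro a b hab
    rw [pow_succ] at hab
    obtain ⟨c, h1, h2⟩ := exists_of_mul_ne_zero _ _ _ _ hab
    exact (ih _ _ h1).tail (h _ _ h2)

theorem Nmat_rtg {n : ℕ} (Λ : Matrix (Fin n) (Fin n) ℝ) (E : Fin n → Fin n → Prop)
    (h : ∀ a b, Λ a b ≠ 0 → E a b) (a b : Fin n) (hN : Nmat Λ a b ≠ 0) :
    Relation.ReflTransGen E a b := by
  rw [Nmat, Matrix.sum_apply] at hN
  obtain ⟨k, -, hk⟩ := Finset.exists_ne_zero_of_sum_ne_zero hN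
  exact pow_rtg Λ E h k a b hk

theorem pow_zero_of_tau {n : ℕ} (Λ : Matrix (Fin n) (Fin n) ℝ) (τ : Fin n → ℕ)
    (hτ : ∀ a, τ a ≤ n) (h : ∀ a b, Λ a b ≠ 0 → τ a < τ b) : Λ ^ (n + 1) = 0 := by
  ext a b
  by_contra hc
  have := pow_tau Λ τ h (n + 1) a b hc
  have := hτ b
  omega

theorem Nmat_mul {n : ℕ} (Λ : Matrix (Fin n) (Fin n) ℝ) (h : Λ ^ (n + 1) = 0) :
    Nmat Λ * (1 - Λ) = 1 := by
  rw [Nmat, geom_sum_mul_neg, h, sub_zero]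

theorem mul_Nmat {n : ℕ} (Λ : Matrix (Fin n) (Fin n) ℝ) (h : Λ ^ (n + 1) = 0) :
    (1 - Λ) * Nmat Λ = 1 := by
  rw [Nmat, mul_neg_geom_sum, h, sub_zero]

theorem phi_eq {n : ℕ} (p : Matrix (Fin n) (Fin n) ℝ × Matrix (Fin n) (Fin n) ℝ)
    (h : p.1 ^ (n + 1) = 0) : phi p = (Nmat p.1)ᵀ * p.2 * Nmat p.1 := by
  have : (1 - p.1)⁻¹ = Nmat p.1 := Matrix.inv_eq_left_inv (Nmat_mul _ h)
  unfold phi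
  convert rfl using 3
  · rw [← this]
  · rw [← this]

theorem Nmat_nonneg {n : ℕ} (Λ : Matrix (Fin n) (Fin n) ℝ) (h : ∀ a b, 0 ≤ Λ a b)
    (a b : Fin n) : 0 ≤ Nmat Λ a b := by
  have hp : ∀ k : ℕ, ∀ a b, 0 ≤ (Λ ^ k) a b := by
    intro k
    induction k with
    | zero => intro a b; rw [pow_zero, Matrix.one_apply]; split_ifs <;> norm_num
    | succ k ih =>
      intro a b
      rw [pow_succ, Matrix.mul_apply]
      exact Finset.sum_nonneg fun c _ => mul_nonneg (ih _ _) (h _ _)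
  rw [Nmat, Matrix.sum_apply]
  exact Finset.sum_nonneg fun k _ => hp k a b

theorem Nmat_apply_eq {n : ℕ} (Λ : Matrix (Fin n) (Fin n) ℝ) (hn : Λ ^ (n + 1) = 0)
    (a b : Fin n) : Nmat Λ a b = (if a = b then 1 else 0) + ∑ c, Λ a c * Nmat Λ c b := by
  have h1 : Nmat Λ = 1 + Λ * Nmat Λ := by
    have := mul_Nmat Λ hn
    rw [sub_mul, one_mul] at this
    rw [← this]; abel
  have h2 := congrFun (congrFun h1 a) b
  rw [Matrix.add_apply, Matrix.one_apply, Matrix.mul_apply] at h2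
  exact h2

theorem Nmat_self_pos {n : ℕ} (Λ : Matrix (Fin n) (Fin n) ℝ) (hn : Λ ^ (n + 1) = 0)
    (h : ∀ a b, 0 ≤ Λ a b) (a : Fin n) : 0 < Nmat Λ a a := by
  rw [Nmat_apply_eq Λ hn, if_pos rfl]
  have : 0 ≤ ∑ c, Λ a c * Nmat Λ c a :=
    Finset.sum_nonneg fun c _ => mul_nonneg (h _ _) (Nmat_nonneg Λ h _ _)
  linarith

theorem Nmat_chain_pos {n : ℕ} (Λ : Matrix (Fin n) (Fin n) ℝ) (hn : Λ ^ (n + 1) = 0)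
    (h : ∀ a b, 0 ≤ Λ a b) (b : Fin n) (l : List (Fin n)) :
    ∀ a, l.IsChain (fun a b => 0 < Λ a b) → l.head? = some a → l.getLast? = some b →
      0 < Nmat Λ a b := by
  induction l with
  | nil => intro a _ h0; simp at h0
  | cons x l ih =>
    intro a hc h1 h2
    obtain rfl : x = a := by simpa using h1
    cases l with
    | nil =>
      obtain rfl : x = b := by simpa using h2
      exact Nmat_self_pos Λ hn h x
    | cons z l =>
      rw [List.isChain_cons_cons] at hc
      have h3 := ih z hc.2 rfl (by simpa using h2)
      rw [Nmat_apply_eq Λ hn]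
      have h4 : 0 < ∑ c, Λ x c * Nmat Λ c b := by
        apply Finset.sum_pos' (fun c _ => mul_nonneg (h _ _) (Nmat_nonneg Λ h _ _))
        exact ⟨z, Finset.mem_univ _, mul_pos hc.1 h3⟩
      have : (0 : ℝ) ≤ if x = b then 1 else 0 := by split_ifs <;> norm_num
      linarith

theorem isChain_consecutive {α : Type} (l : List α) : l.IsChain (fun a b => [a, b] <:+: l) := by
  induction l with
  | nil => exact List.isChain_nil
  | cons x l ih =>
    cases l with
    | nil => exact List.isChain_singleton _
    | cons z l =>
      rw [List.isChain_cons_cons]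
      exact ⟨⟨[], l, rfl⟩, ih.imp fun a b hab => hab.trans (List.suffix_cons _ _).isInfix⟩

/-- The matrix of the linear system for one vertex. -/
noncomputable def Mmat {n : ℕ} {ι : Type} (H : Fin n → Prop) (y t : ι → Fin n)
    (p : Matrix (Fin n) (Fin n) ℝ × Matrix (Fin n) (Fin n) ℝ) : Matrix ι ι ℝ :=
  Matrix.of fun i j => if H (y i) then (p.2 * Nmat p.1) (y i) (t j)
    else ((Nmat p.1)ᵀ * p.2 * Nmat p.1) (y i) (t j)

/-- Linear span of the parameter space. -/
def Wset {n : ℕ} (D B : Finset (Fin n × Fin n)) :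
    Set (Matrix (Fin n) (Fin n) ℝ × Matrix (Fin n) (Fin n) ℝ) :=
  {p | (∀ v w, p.1 v w ≠ 0 → (v, w) ∈ D) ∧ (∀ v w, p.2 v w = p.2 w v) ∧
    ∀ v w, v ≠ w → p.2 v w ≠ 0 → (v, w) ∈ B}

theorem witness {n : ℕ} {ι : Type} [Fintype ι] [DecidableEq ι] (D B : Finset (Fin n × Fin n))
    (hG : IsMixedGraph D B) (hacyc : Acyclic D) (t : ι → Fin n)
    (Y : Finset (Fin n)) (H : Fin n → Prop) (y₀ : ι → Fin n) (R₀ : ι → List (Fin n))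
    (h₀ : HSys D B t Y y₀ R₀) :
    ∃ y : ι → Fin n, (∀ i, y i ∈ Y) ∧ ∃ p ∈ Wset D B, (Mmat H y t p).det ≠ 0 := by
  obtain ⟨τ, hτ, hτD⟩ := exists_topo D hacyc
  obtain ⟨⟨y, R⟩, hsys, hmin'⟩ : ∃ x : (ι → Fin n) × (ι → List (Fin n)),
      HSys D B t Y x.1 x.2 ∧ ∀ y' R', HSys D B t Y y' R' → hcost x.1 x.2 ≤ hcost y' R' := by
    let S : Set ((ι → Fin n) × (ι → List (Fin n))) := {x | HSys D B t Y x.1 x.2}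
    obtain ⟨x, hx, hm⟩ := exists_minimalFor_of_wellFoundedLT (fun x => x ∈ S)
      (fun x => hcost x.1 x.2) ⟨(y₀, R₀), h₀⟩
    refine ⟨x, hx, fun y' R' h' => ?_⟩
    by_contra hc
    push Not at hc
    exact absurd (hm (j := (y', R')) h' hc.le) (not_le.2 hc)
  simp only at hsys hmin'
  have hsys' := hsys
  obtain ⟨hinj, htr, hdis⟩ := hsys'
  have huniq : ∀ x i j, x ∈ R i → x ∈ R j → i = j := by
    intro x i j hi hj
    by_contra hc
    exact hdis i j hc x hi hj
  -- the successor map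
  have hs : ∀ q, ∃ r, (y q ∈ R r) ∨ (r = q ∧ ∀ r', y q ∉ R r') := by
    intro q
    by_cases h : ∃ r, y q ∈ R r
    · obtain ⟨r, hr⟩ := h; exact ⟨r, Or.inl hr⟩
    · push Not at h; exact ⟨q, Or.inr ⟨rfl, h⟩⟩
  choose s hs using hs
  have hsu : ∀ q r, y q ∈ R r → s q = r := by
    intro q r hr
    rcases hs q with h | h
    · exact huniq _ _ _ h hr
    · exact absurd hr (h.2 r)
  have hper := reroute D B t Y y R hsys hmin' s (fun q => (hs q).imp id fun h => h.1)
  obtain ⟨d, hd⟩ := exists_rank s fun q hq => (hper q hq).1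
  have hhd : ∀ i, ∃ a, (R i).head? = some a ∧ a ∈ R i ∧ (a = y i ∨ (y i, a) ∈ B) := by
    intro i
    obtain ⟨-, h2, -, -, -, -, h7⟩ := (htr i).2
    rcases h7 with h | ⟨u, z, hu, hz, huz⟩
    · exact ⟨y i, by rw [← h]; rfl, List.mem_of_mem_head? (by rw [← h]; rfl), Or.inl rfl⟩
    · obtain rfl : y i = u := by simpa using hu
      exact ⟨z, hz, List.mem_of_mem_head? hz, Or.inr huz⟩
  choose hd' hhd1 hhd2 hhd3 using hhd
  have htR : ∀ i, t i ∈ R i := by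
    intro i
    exact List.mem_of_getLast? (htr i).2.2.2.2.2.2.1
  let E : Fin n → Fin n → Prop := fun a b => ∃ i, [a, b] <:+: R i
  have hED : ∀ a b, E a b → (a, b) ∈ D := by
    rintro a b ⟨i, hi⟩
    have h1 : (R i).IsChain (fun a b => (a, b) ∈ D) := (htr i).2.2.2.2.1
    obtain ⟨l₂, l₃, hl⟩ := hi
    rw [← hl] at h1
    have := h1.left_of_append.right_of_append
    rw [List.isChain_cons_cons] at this
    exact this.1
  have hEm : ∀ a b, E a b → ∀ i, (a ∈ R i ↔ b ∈ R i) := by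
    rintro a b ⟨j, hj⟩ i
    have ha : a ∈ R j := hj.subset (by simp)
    have hb : b ∈ R j := hj.subset (by simp)
    constructor
    · intro h; rw [huniq _ _ _ h ha]; exact hb
    · intro h; rw [huniq _ _ _ h hb]; exact ha
  have hEmR : ∀ a b, Relation.ReflTransGen E a b → ∀ i, (a ∈ R i ↔ b ∈ R i) := by
    intro a b hab i
    induction hab with
    | refl => rfl
    | tail _ h ih => rw [ih, hEm _ _ h]
  have hEt : ∀ a b, Relation.ReflTransGen E a b → a = b ∨
      (τ a < τ b ∧ ∃ i, a ∈ R i ∧ b ∈ R i) := by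
    intro a b hab
    have hle : ∀ b, Relation.ReflTransGen E a b → τ a ≤ τ b := by
      intro b hab
      induction hab with
      | refl => rfl
      | tail _ h ih => exact ih.trans (hτD _ _ (hED _ _ h)).le
    rcases Relation.ReflTransGen.cases_tail hab with h | ⟨c, hac, hcb⟩
    · left; exact h.symm
    · right
      refine ⟨(hle c hac).trans_lt (hτD _ _ (hED _ _ hcb)), ?_⟩
      obtain ⟨i, hi⟩ := hcb
      have hb : b ∈ R i := hi.subset (by simp)
      exact ⟨i, (hEmR _ _ hab i).2 hb, hb⟩
  let Λ : Matrix (Fin n) (Fin n) ℝ := Matrix.of fun a b => if E a b then 1 else 0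
  have hΛE : ∀ a b, Λ a b ≠ 0 → E a b := by
    intro a b h
    by_contra hc
    exact h (if_neg hc)
  have hΛ0 : ∀ a b, 0 ≤ Λ a b := by
    intro a b
    change (0 : ℝ) ≤ if E a b then 1 else 0
    split_ifs <;> norm_num
  have hΛ1 : ∀ a b, E a b → 0 < Λ a b := by
    intro a b h
    have : Λ a b = 1 := if_pos h
    rw [this]; norm_num
  have hnil : Λ ^ (n + 1) = 0 :=
    pow_zero_of_tau Λ τ hτ fun a b h => hτD _ _ (hED _ _ (hΛE _ _ h))
  let P : Fin n → Fin n → Prop := fun u z => ∃ i, (u = y i ∧ z = hd' i) ∨ (u = hd' i ∧ z = y i)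
  let Ω : Matrix (Fin n) (Fin n) ℝ := Matrix.of fun a b => if P a b then 1 else 0
  have hΩP : ∀ a b, Ω a b ≠ 0 → P a b := by
    intro a b h
    by_contra hc
    exact h (if_neg hc)
  have hΩ0 : ∀ a b, 0 ≤ Ω a b := by
    intro a b
    change (0 : ℝ) ≤ if P a b then 1 else 0
    split_ifs <;> norm_num
  have hPs : ∀ a b, P a b → P b a := by
    rintro a b ⟨i, h | h⟩
    · exact ⟨i, Or.inr ⟨h.2, h.1⟩⟩
    · exact ⟨i, Or.inl ⟨h.2, h.1⟩⟩
  have hN0 := Nmat_nonneg Λ hΛ0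
  have hNR := Nmat_rtg Λ E hΛE
  refine ⟨y, fun i => (htr i).1, (Λ, Ω), ⟨?_, ?_, ?_⟩, ?_⟩
  · exact fun v w h => hED _ _ (hΛE _ _ h)
  · intro v w
    change (if P v w then (1 : ℝ) else 0) = if P w v then 1 else 0
    simp only [show P v w ↔ P w v from ⟨hPs _ _, hPs _ _⟩]
  · intro v w hvw h
    obtain ⟨i, h | h⟩ := hΩP _ _ h
    · rcases hhd3 i with h3 | h3
      · exact absurd (h.1.trans (h3.symm.trans h.2.symm)) hvw
      · rw [h.1, h.2]; exact h3
    · rcases hhd3 i with h3 | h3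
      · exact absurd (h.1.trans (h3.trans h.2.symm)) hvw
      · rw [h.1, h.2]; exact hG.1 _ _ h3
  · have hΩ1 : ∀ i, Ω (y i) (hd' i) = 1 := fun i => if_pos ⟨i, Or.inl ⟨rfl, rfl⟩⟩
    have hNp : ∀ i, 0 < Nmat Λ (hd' i) (t i) := by
      intro i
      apply Nmat_chain_pos Λ hnil hΛ0 (t i) (R i) _ _ (hhd1 i) (htr i).2.2.2.2.2.2.1
      exact (isChain_consecutive (R i)).imp fun a b h => hΛ1 a b ⟨i, h⟩
    have hON0 : ∀ a b, 0 ≤ (Ω * Nmat Λ) a b := by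
      intro a b
      rw [Matrix.mul_apply]
      exact Finset.sum_nonneg fun c _ => mul_nonneg (hΩ0 _ _) (hN0 _ _)
    have hONp : ∀ i, 0 < (Ω * Nmat Λ) (y i) (t i) := by
      intro i
      rw [Matrix.mul_apply]
      refine Finset.sum_pos' (fun c _ => mul_nonneg (hΩ0 _ _) (hN0 _ _))
        ⟨hd' i, Finset.mem_univ _, ?_⟩
      rw [hΩ1, one_mul]; exact hNp i
    have hentry : ∀ i j, Mmat H y t (Λ, Ω) i j ≠ 0 → ∃ u z, Relation.ReflTransGen E u (y i) ∧
        P u z ∧ Relation.ReflTransGen E z (t j) := by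
      intro i j hM
      have hM' : (if H (y i) then (Ω * Nmat Λ) (y i) (t j)
        else ((Nmat Λ)ᵀ * Ω * Nmat Λ) (y i) (t j)) ≠ 0 := hM
      split_ifs at hM' with hH
      · obtain ⟨z, h1, h2⟩ := exists_of_mul_ne_zero _ _ _ _ hM'
        exact ⟨y i, z, Relation.ReflTransGen.refl, hΩP _ _ h1, hNR _ _ h2⟩
      · rw [Matrix.mul_assoc] at hM'
        obtain ⟨u, h1, h2⟩ := exists_of_mul_ne_zero _ _ _ _ hM'
        obtain ⟨z, h3, h4⟩ := exists_of_mul_ne_zero _ _ _ _ h2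
        exact ⟨u, z, hNR _ _ h1, hΩP _ _ h3, hNR _ _ h4⟩
    apply det_ne_zero_of_tri (α := ℕ ×ₗ ℕ) _ (fun i => toLex (d (s i), τ (y i)))
    · intro i
      apply ne_of_gt
      change 0 < if H (y i) then (Ω * Nmat Λ) (y i) (t i)
        else ((Nmat Λ)ᵀ * Ω * Nmat Λ) (y i) (t i)
      split_ifs
      · exact hONp i
      · rw [Matrix.mul_assoc, Matrix.mul_apply]
        refine Finset.sum_pos' (fun c _ => mul_nonneg (hN0 _ _) (hON0 _ _))
          ⟨y i, Finset.mem_univ _, ?_⟩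
        exact mul_pos (Nmat_self_pos Λ hnil hΛ0 _) (hONp i)
    · intro q p hM
      obtain ⟨u, z, hu, ⟨r, hr⟩, hz⟩ := hentry q p hM
      have hzp : z ∈ R p := (hEmR _ _ hz p).2 (htR p)
      have case1 : u = y r ∧ z = hd' r → q = p ∨
          toLex (d (s p), τ (y p)) < toLex (d (s q), τ (y q)) := by
        rintro ⟨h1, h2⟩
        have hrp : r = p := huniq z _ _ (h2 ▸ hhd2 r) hzp
        rw [h1, hrp] at hu
        rcases hEt _ _ hu with h | ⟨hlt, i, hi1, hi2⟩
        · left; exact (hinj h).symm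
        · right
          rw [Prod.Lex.toLex_lt_toLex]
          right
          exact ⟨by simp only [hsu _ _ hi1, hsu _ _ hi2], hlt⟩
      rcases hr with hr | ⟨h1, h2⟩
      · exact case1 hr
      · by_cases hyr : hd' r = y r
        · exact case1 ⟨by rw [h1, hyr], by rw [h2, hyr]⟩
        · right
          have hq : s q = r := hsu _ _ ((hEmR _ _ hu r).1 (h1 ▸ hhd2 r))
          have hr' : s r = p := hsu _ _ (h2 ▸ hzp)
          have hne : s r ≠ r := by
            intro hc
            have hrr : y r ∈ R r := by
              have : p = r := hr'.symm.trans hc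
              rw [← h2, ← this]; exact hzp
            have := (hper r (Function.mk_mem_periodicPts (n := 1) one_pos hc)).2 hrr
            rw [hhd1] at this
            exact hyr (Option.some.inj this)
          rw [Prod.Lex.toLex_lt_toLex]
          left
          have h3 := (hd r).2 hne
          have h4 := (hd p).1
          simp only [hq]
          rw [hr'] at h3
          exact h4.trans_lt h3


/-- Polynomial functions of the two parameter matrices. -/
def IsPolyFun {n : ℕ} (g : Matrix (Fin n) (Fin n) ℝ × Matrix (Fin n) (Fin n) ℝ → ℝ) : Prop :=
  ∃ f : MvPolynomial ((Fin n × Fin n) ⊕ (Fin n × Fin n)) ℝ, ∀ p, polyEval f p = g p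

namespace IsPolyFun
variable {n : ℕ} {g h : Matrix (Fin n) (Fin n) ℝ × Matrix (Fin n) (Fin n) ℝ → ℝ}

theorem const (c : ℝ) : IsPolyFun (n := n) (fun _ => c) :=
  ⟨MvPolynomial.C c, fun p => by simp [polyEval]⟩

theorem add (hg : IsPolyFun g) (hh : IsPolyFun h) : IsPolyFun (fun p => g p + h p) := by
  obtain ⟨a, ha⟩ := hg
  obtain ⟨b, hb⟩ := hh
  exact ⟨a + b, fun p => by beta_reduce; rw [← ha, ← hb]; simp [polyEval]⟩

theorem mul (hg : IsPolyFun g) (hh : IsPolyFun h) : IsPolyFun (fun p => g p * h p) := by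
  obtain ⟨a, ha⟩ := hg
  obtain ⟨b, hb⟩ := hh
  exact ⟨a * b, fun p => by beta_reduce; rw [← ha, ← hb]; simp [polyEval]⟩

theorem fst (a b : Fin n) : IsPolyFun (n := n) (fun p => p.1 a b) :=
  ⟨MvPolynomial.X (Sum.inl (a, b)), fun p => by simp [polyEval]⟩

theorem snd (a b : Fin n) : IsPolyFun (n := n) (fun p => p.2 a b) :=
  ⟨MvPolynomial.X (Sum.inr (a, b)), fun p => by simp [polyEval]⟩

theorem sum {κ : Type} (S : Finset κ)
    (F : κ → Matrix (Fin n) (Fin n) ℝ × Matrix (Fin n) (Fin n) ℝ → ℝ)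
    (hF : ∀ k, IsPolyFun (F k)) : IsPolyFun (fun p => ∑ k ∈ S, F k p) := by
  induction S using Finset.induction_on with
  | empty => simpa using const 0
  | insert a S ha ih =>
    simp only [Finset.sum_insert ha]
    exact (hF a).add ih

theorem prod {κ : Type} (S : Finset κ)
    (F : κ → Matrix (Fin n) (Fin n) ℝ × Matrix (Fin n) (Fin n) ℝ → ℝ)
    (hF : ∀ k, IsPolyFun (F k)) : IsPolyFun (fun p => ∏ k ∈ S, F k p) := by
  induction S using Finset.induction_on with
  | empty => simpa using const 1
  | insert a S ha ih =>
    simp only [Finset.prod_insert ha]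
    exact (hF a).mul ih

theorem matMul {ι κ l : Type} [Fintype κ]
    (F : Matrix (Fin n) (Fin n) ℝ × Matrix (Fin n) (Fin n) ℝ → Matrix ι κ ℝ)
    (G : Matrix (Fin n) (Fin n) ℝ × Matrix (Fin n) (Fin n) ℝ → Matrix κ l ℝ)
    (hF : ∀ a b, IsPolyFun (fun p => F p a b)) (hG : ∀ a b, IsPolyFun (fun p => G p a b))
    (a : ι) (b : l) : IsPolyFun (fun p => (F p * G p) a b) := by
  simp only [Matrix.mul_apply]
  exact sum _ _ fun c => (hF a c).mul (hG c b)

theorem nmat (a b : Fin n) : IsPolyFun (n := n) (fun p => Nmat p.1 a b) := by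
  have hp : ∀ k : ℕ, ∀ a b, IsPolyFun (n := n) (fun p => (p.1 ^ k) a b) := by
    intro k
    induction k with
    | zero => intro a b; simp only [pow_zero]; exact const _
    | succ k ih =>
      intro a b
      simp only [pow_succ]
      exact matMul _ _ ih fst a b
  simp only [Nmat, Matrix.sum_apply]
  exact sum _ _ fun k => hp k a b

theorem det {ι : Type} [Fintype ι] [DecidableEq ι]
    (F : Matrix (Fin n) (Fin n) ℝ × Matrix (Fin n) (Fin n) ℝ → Matrix ι ι ℝ)
    (hF : ∀ a b, IsPolyFun (fun p => F p a b)) : IsPolyFun (fun p => (F p).det) := by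
  simp only [Matrix.det_apply']
  exact sum _ _ fun σ => (const _).mul (prod _ _ fun i => hF _ _)

theorem mmat {ι : Type} (H : Fin n → Prop) (y t : ι → Fin n) (i j : ι) :
    IsPolyFun (fun p => Mmat H y t p i j) := by
  simp only [Mmat, Matrix.of_apply]
  by_cases hH : H (y i)
  · simp only [if_pos hH]
    exact matMul _ _ snd nmat _ _
  · simp only [if_neg hH]
    refine matMul _ _ (fun a b => matMul _ _ (fun a b => ?_) snd a b) nmat _ _
    simp only [Matrix.transpose_apply]
    exact nmat _ _

theorem line (hg : IsPolyFun g) (p q : Matrix (Fin n) (Fin n) ℝ × Matrix (Fin n) (Fin n) ℝ) :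
    ∃ P : Polynomial ℝ, ∀ t : ℝ, P.eval t = g (p + t • q) := by
  obtain ⟨f, hf⟩ := hg
  let F : (Fin n × Fin n) ⊕ (Fin n × Fin n) → Polynomial ℝ :=
    Sum.elim (fun e => Polynomial.C (p.1 e.1 e.2) + Polynomial.X * Polynomial.C (q.1 e.1 e.2))
      (fun e => Polynomial.C (p.2 e.1 e.2) + Polynomial.X * Polynomial.C (q.2 e.1 e.2))
  refine ⟨MvPolynomial.aeval F f, fun t => ?_⟩
  rw [← hf, ← Polynomial.coe_aeval_eq_eval, MvPolynomial.comp_aeval_apply, polyEval,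
    ← MvPolynomial.coe_aeval_eq_eval]
  simp only [RingHom.coe_coe]
  congr 2
  funext e
  rcases e with e | e <;> (simp [F]; try ring)

end IsPolyFun

theorem Wset_line {n : ℕ} (D B : Finset (Fin n × Fin n))
    (p q : Matrix (Fin n) (Fin n) ℝ × Matrix (Fin n) (Fin n) ℝ)
    (hp : p ∈ Wset D B) (hq : q ∈ Wset D B) (t : ℝ) : p + t • q ∈ Wset D B := by
  obtain ⟨p1, p2, p3⟩ := hp
  obtain ⟨q1, q2, q3⟩ := hq
  refine ⟨fun v w h => ?_, fun v w => ?_, fun v w hvw h => ?_⟩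
  · by_contra hc
    have h1 : p.1 v w = 0 := by by_contra h; exact hc (p1 _ _ h)
    have h2 : q.1 v w = 0 := by by_contra h; exact hc (q1 _ _ h)
    exact h (by simp [h1, h2])
  · simp [p2 v w, q2 v w]
  · by_contra hc
    have h1 : p.2 v w = 0 := by by_contra h; exact hc (p3 _ _ hvw h)
    have h2 : q.2 v w = 0 := by by_contra h; exact hc (q3 _ _ hvw h)
    exact h (by simp [h1, h2])

theorem exists_common {n : ℕ} (D B : Finset (Fin n × Fin n)) {κ : Type} (S : Finset κ)
    (F : κ → Matrix (Fin n) (Fin n) ℝ × Matrix (Fin n) (Fin n) ℝ → ℝ)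
    (hF : ∀ k, IsPolyFun (F k)) (hW : ∀ k, ∃ p ∈ Wset D B, F k p ≠ 0) :
    ∃ p ∈ Wset D B, ∏ k ∈ S, F k p ≠ 0 := by
  induction S using Finset.induction_on with
  | empty => exact ⟨0, ⟨by simp, by simp, by simp⟩, by simp⟩
  | insert a S ha ih =>
    obtain ⟨p, hp, hp'⟩ := ih
    obtain ⟨q, hq, hq'⟩ := hW a
    have hqp : q - p ∈ Wset D B := by
      have := Wset_line D B q p hq hp (-1)
      simpa [sub_eq_add_neg] using this
    obtain ⟨P, hP⟩ := (IsPolyFun.prod S F hF).line p (q - p)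
    obtain ⟨Q, hQ⟩ := (hF a).line p (q - p)
    have hP0 : P ≠ 0 := by
      rintro rfl
      have := hP 0
      simp only [Polynomial.eval_zero, zero_smul, add_zero] at this
      exact hp' this.symm
    have hQ0 : Q ≠ 0 := by
      rintro rfl
      have := hQ 1
      simp only [Polynomial.eval_zero, one_smul, add_sub_cancel] at this
      exact hq' this.symm
    have : ∃ t, (Q * P).eval t ≠ 0 := by
      by_contra hc
      push Not at hc
      exact mul_ne_zero hQ0 hP0 (Polynomial.funext fun t => by simpa using hc t)
    obtain ⟨t, ht⟩ := this
    refine ⟨p + t • (q - p), Wset_line D B _ _ hp hqp t, ?_⟩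
    rw [Finset.prod_insert ha, ← hP, ← hQ, ← Polynomial.eval_mul]
    exact ht

theorem posDef_add {n : ℕ} (S : Matrix (Fin n) (Fin n) ℝ) (hS : ∀ v w, S v w = S w v) (T : ℝ)
    (hT : ∑ i, ∑ j, |S i j| < T) : (S + T • (1 : Matrix (Fin n) (Fin n) ℝ)).PosDef := by
  apply Matrix.PosDef.of_dotProduct_mulVec_pos
  · ext i j
    simp [Matrix.conjTranspose_apply, hS j i, Matrix.one_apply, eq_comm]
  · intro x hx
    have h0 : 0 < ∑ k, x k ^ 2 := by
      obtain ⟨k, hk⟩ := Function.ne_iff.1 hx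
      exact Finset.sum_pos' (fun i _ => sq_nonneg _) ⟨k, Finset.mem_univ _, by
        have : x k ≠ 0 := hk
        positivity⟩
    have h1 : star x ⬝ᵥ ((S + T • (1 : Matrix (Fin n) (Fin n) ℝ)) *ᵥ x) =
        (∑ i, ∑ j, S i j * (x i * x j)) + T * ∑ k, x k ^ 2 := by
      rw [Matrix.add_mulVec, dotProduct_add, Matrix.smul_mulVec, Matrix.one_mulVec]
      congr 1
      · simp only [dotProduct, Matrix.mulVec, star_trivial, Finset.mul_sum]
        exact Finset.sum_congr rfl fun i _ => Finset.sum_congr rfl fun j _ => by ring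
      · simp only [dotProduct, star_trivial, Finset.mul_sum, Pi.smul_apply, smul_eq_mul]
        exact Finset.sum_congr rfl fun i _ => by ring
    have h2 : ∀ i j, -(|S i j| * ∑ k, x k ^ 2) ≤ S i j * (x i * x j) := by
      intro i j
      have hi : x i ^ 2 ≤ ∑ k, x k ^ 2 :=
        Finset.single_le_sum (f := fun k => x k ^ 2) (fun k _ => sq_nonneg _) (Finset.mem_univ i)
      have hj : x j ^ 2 ≤ ∑ k, x k ^ 2 :=
        Finset.single_le_sum (f := fun k => x k ^ 2) (fun k _ => sq_nonneg _) (Finset.mem_univ j)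
      have h3 : |x i * x j| ≤ ∑ k, x k ^ 2 := by
        rw [abs_le]
        constructor <;> nlinarith [sq_nonneg (x i + x j), sq_nonneg (x i - x j)]
      have h4 : |S i j * (x i * x j)| ≤ |S i j| * ∑ k, x k ^ 2 := by
        rw [abs_mul]
        exact mul_le_mul_of_nonneg_left h3 (abs_nonneg _)
      exact (abs_le.1 h4).1
    have h5 : -((∑ i, ∑ j, |S i j|) * ∑ k, x k ^ 2) ≤ ∑ i, ∑ j, S i j * (x i * x j) := by
      rw [Finset.sum_mul, ← Finset.sum_neg_distrib]
      refine Finset.sum_le_sum fun i _ => ?_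
      rw [Finset.sum_mul, ← Finset.sum_neg_distrib]
      exact Finset.sum_le_sum fun j _ => h2 i j
    rw [h1]
    nlinarith [mul_lt_mul_of_pos_right hT h0]

theorem exists_theta {n : ℕ} (D B : Finset (Fin n × Fin n))
    (g : Matrix (Fin n) (Fin n) ℝ × Matrix (Fin n) (Fin n) ℝ → ℝ)
    (hg : IsPolyFun g) (hW : ∃ p ∈ Wset D B, g p ≠ 0) :
    ∃ p ∈ Theta (D : Set (Fin n × Fin n)) B, g p ≠ 0 := by
  obtain ⟨p, hp, hgp⟩ := hW
  obtain ⟨P, hP⟩ := hg.line p (0, 1)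
  have hP0 : P ≠ 0 := by
    rintro rfl
    have := hP 0
    simp only [Polynomial.eval_zero, zero_smul, add_zero] at this
    exact hgp this.symm
  have : ∃ T, ∑ i, ∑ j, |p.2 i j| < T ∧ P.eval T ≠ 0 := by
    by_contra hc
    push Not at hc
    exact hP0 (Polynomial.eq_zero_of_infinite_isRoot P
      ((Set.Ioi_infinite (∑ i, ∑ j, |p.2 i j|)).mono fun T hT => hc T hT))
  obtain ⟨T, hT, hPT⟩ := this
  refine ⟨p + T • (0, 1), ⟨?_, ?_, ?_⟩, by rw [← hP]; exact hPT⟩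
  · intro v w h
    exact hp.1 v w (by simpa using h)
  · exact posDef_add p.2 hp.2.1 T hT
  · intro v w hvw h
    exact hp.2.2 v w hvw (by simpa [Matrix.one_apply, hvw] using h)


theorem theta_nil {n : ℕ} (D B : Finset (Fin n × Fin n)) (hacyc : Acyclic D)
    (p : Matrix (Fin n) (Fin n) ℝ × Matrix (Fin n) (Fin n) ℝ)
    (hp : p ∈ Theta (D : Set (Fin n × Fin n)) B) : p.1 ^ (n + 1) = 0 := by
  obtain ⟨τ, hτ, hτD⟩ := exists_topo D hacyc
  exact pow_zero_of_tau p.1 τ hτ fun a b h => hτD _ _ (hp.1 a b h)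

theorem theta_facts {n : ℕ} (p : Matrix (Fin n) (Fin n) ℝ × Matrix (Fin n) (Fin n) ℝ)
    (h : p.1 ^ (n + 1) = 0) :
    phi p * (1 - p.1) = (Nmat p.1)ᵀ * p.2 ∧ (1 - p.1)ᵀ * phi p = p.2 * Nmat p.1 ∧
      (1 - p.1)ᵀ * phi p * (1 - p.1) = p.2 := by
  have h1 : phi p * (1 - p.1) = (Nmat p.1)ᵀ * p.2 := by
    rw [phi_eq p h, Matrix.mul_assoc, Nmat_mul _ h, Matrix.mul_one]
  have h2 : (1 - p.1)ᵀ * phi p = p.2 * Nmat p.1 := by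
    rw [phi_eq p h, Matrix.mul_assoc, ← Matrix.mul_assoc, ← Matrix.transpose_mul, Nmat_mul _ h,
      Matrix.transpose_one, Matrix.one_mul]
  refine ⟨h1, h2, ?_⟩
  rw [h2, Matrix.mul_assoc, Nmat_mul _ h, Matrix.mul_one]

theorem theta_omega_zero {n : ℕ} (D B : Finset (Fin n × Fin n))
    (p : Matrix (Fin n) (Fin n) ℝ × Matrix (Fin n) (Fin n) ℝ)
    (hp : p ∈ Theta (D : Set (Fin n × Fin n)) B) (y v : Fin n) (h1 : y ≠ v) (h2 : (y, v) ∉ B) :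
    p.2 y v = 0 := by
  by_contra hc
  exact h2 (hp.2.2 y v h1 hc)

theorem theta_not_htr {n : ℕ} (D B : Finset (Fin n × Fin n)) (hG : IsMixedGraph D B)
    (p : Matrix (Fin n) (Fin n) ℝ × Matrix (Fin n) (Fin n) ℝ)
    (hp : p ∈ Theta (D : Set (Fin n × Fin n)) B) (y v : Fin n) (h1 : y ≠ v) (h2 : (y, v) ∉ B)
    (hy : y ∉ htr D B v) : ((Nmat p.1)ᵀ * p.2) y v = 0 := by
  by_contra hc
  obtain ⟨u, hu, huv⟩ := exists_of_mul_ne_zero _ _ _ _ hc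
  have hr := Nmat_rtg p.1 (fun a b => (a, b) ∈ D) (fun a b h => hp.1 a b h) u y hu
  obtain ⟨l, hl1, hl2⟩ := List.exists_isChain_cons_of_relationReflTransGen hr
  apply hy
  refine ⟨h1, fun h => h2 (hG.1 _ _ h), u :: l, by simp, by simp, List.isChain_singleton _, hl1,
    by simp, ?_, ?_⟩
  · rw [List.getLast?_eq_some_getLast (by simp), hl2]
  · by_cases huv' : u = v
    · left; simp [huv']
    · right
      exact ⟨v, u, rfl, rfl, hG.1 _ _ (hp.2.2 u v huv' huv)⟩

theorem column_eq {n : ℕ} (D B : Finset (Fin n × Fin n)) (hG : IsMixedGraph D B)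
    (hacyc : Acyclic D) (v : Fin n) (y : {w // w ∈ paF D v} → Fin n)
    (hy1 : ∀ i, y i ≠ v ∧ (y i, v) ∉ B)
    (p q : Matrix (Fin n) (Fin n) ℝ × Matrix (Fin n) (Fin n) ℝ)
    (hp : p ∈ Theta (D : Set (Fin n × Fin n)) B) (hq : q ∈ Theta (D : Set (Fin n × Fin n)) B)
    (hpq : phi p = phi q)
    (hdet : (Mmat (fun w => w ∈ htr D B v) y Subtype.val p).det ≠ 0)
    (ih : ∀ i, y i ∈ htr D B v → ∀ u, p.1 u (y i) = q.1 u (y i)) (u : Fin n) :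
    p.1 u v = q.1 u v := by
  have hpn := theta_nil D B hacyc p hp
  have hqn := theta_nil D B hacyc q hq
  obtain ⟨p1, p2, p3⟩ := theta_facts p hpn
  obtain ⟨q1, q2, q3⟩ := theta_facts q hqn
  have hsub : ∀ (c : Fin n → ℝ) (A C : Matrix (Fin n) (Fin n) ℝ),
      (∑ w, c w * (1 - A) w v = 0) → (∑ w, c w * (1 - C) w v = 0) →
      ∑ w, c w * (A w v - C w v) = 0 := by
    intro c A C h1 h2
    have : ∑ w, c w * (A w v - C w v) =
        ∑ w, c w * (1 - C) w v - ∑ w, c w * (1 - A) w v := by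
      rw [← Finset.sum_sub_distrib]
      refine Finset.sum_congr rfl fun w _ => ?_
      simp only [Matrix.sub_apply]; ring
    rw [this, h1, h2, sub_zero]
  have hpa : ∀ c : Fin n → ℝ, ∑ w, c w * (p.1 w v - q.1 w v) =
      ∑ i : {w // w ∈ paF D v}, c i * (p.1 i v - q.1 i v) := by
    intro c
    rw [Finset.sum_coe_sort (paF D v) (fun w => c w * (p.1 w v - q.1 w v))]
    symm
    apply Finset.sum_subset (Finset.subset_univ _)
    intro w _ hw
    have hw' : (w, v) ∉ D := by simpa [paF] using hw
    have h1 : p.1 w v = 0 := by by_contra h; exact hw' (hp.1 _ _ h)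
    have h2 : q.1 w v = 0 := by by_contra h; exact hw' (hq.1 _ _ h)
    rw [h1, h2]; ring
  have hrow : Mmat (fun w => w ∈ htr D B v) y Subtype.val p *ᵥ
      (fun i => p.1 i v - q.1 i v) = 0 := by
    funext i
    simp only [Matrix.mulVec, dotProduct, Mmat, Matrix.of_apply, Pi.zero_apply]
    by_cases hH : y i ∈ htr D B v
    · simp only [if_pos hH]
      rw [← hpa]
      apply hsub
      · rw [← Matrix.mul_apply, ← p2, p3]
        exact theta_omega_zero D B p hp _ _ (hy1 i).1 (hy1 i).2
      · have hrow' : ∀ c, (p.2 * Nmat p.1) (y i) c = (q.2 * Nmat q.1) (y i) c := by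
          intro c
          rw [← p2, ← q2, hpq, Matrix.mul_apply, Matrix.mul_apply]
          refine Finset.sum_congr rfl fun w _ => ?_
          simp only [Matrix.transpose_apply, Matrix.sub_apply, ih i hH]
        simp only [hrow']
        rw [← Matrix.mul_apply, ← q2, q3]
        exact theta_omega_zero D B q hq _ _ (hy1 i).1 (hy1 i).2
    · simp only [if_neg hH]
      rw [← hpa, ← phi_eq p hpn]
      apply hsub
      · rw [← Matrix.mul_apply, p1]
        exact theta_not_htr D B hG p hp _ _ (hy1 i).1 (hy1 i).2 hH
      · rw [hpq, ← Matrix.mul_apply, q1]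
        exact theta_not_htr D B hG q hq _ _ (hy1 i).1 (hy1 i).2 hH
  have hzero := Matrix.eq_zero_of_mulVec_eq_zero hdet hrow
  by_cases hu : u ∈ paF D v
  · have := congrFun hzero ⟨u, hu⟩
    simp only [Pi.zero_apply] at this
    linarith
  · have hw' : (u, v) ∉ D := by simpa [paF] using hu
    have h1 : p.1 u v = 0 := by by_contra h; exact hw' (hp.1 _ _ h)
    have h2 : q.1 u v = 0 := by by_contra h; exact hw' (hq.1 _ _ h)
    rw [h1, h2]

theorem stmt8 (n : ℕ) (D B : Finset (Fin n × Fin n))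
    (hG : IsMixedGraph D B) (hacyc : Acyclic D)
    (Y : Fin n → Finset (Fin n)) (hY : ∀ v : Fin n, SatisfiesHTC D B v (Y v))
    (hord : ∃ lt : Fin n → Fin n → Prop, IsStrictTotalOrder (Fin n) lt ∧
      ∀ v w : Fin n, w ∈ Y v → w ∈ htr D B v → lt w v) :
    GenId (↑D : Set (Fin n × Fin n)) ↑B := by
  obtain ⟨lt, hlt, hlt'⟩ := hord
  have hwit : ∀ v, ∃ y : {w // w ∈ paF D v} → Fin n, (∀ i, y i ∈ Y v) ∧
      ∃ p ∈ Wset D B, (Mmat (fun w => w ∈ htr D B v) y Subtype.val p).det ≠ 0 := by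
    intro v
    obtain ⟨-, -, src, R, h1, h2⟩ := hY v
    refine witness D B hG hacyc _ (Y v) _ (fun i => src i) (fun i => R i) ⟨?_, ?_, ?_⟩
    · intro i j hij
      by_contra hc
      exact (h2 i i.2 j j.2 (fun h => hc (Subtype.ext h))).1 hij
    · exact fun i => h1 i i.2
    · exact fun i j hij => (h2 i i.2 j j.2 (fun h => hij (Subtype.ext h))).2
  choose y hyY hyW using hwit
  have hpoly : ∀ v, IsPolyFun (fun p =>
      (Mmat (fun w => w ∈ htr D B v) (y v) Subtype.val p).det) :=
    fun v => IsPolyFun.det _ fun i j => IsPolyFun.mmat _ _ _ i j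
  have hprod := IsPolyFun.prod Finset.univ _ hpoly
  have hex := exists_theta D B _ hprod (exists_common D B Finset.univ _ hpoly hyW)
  obtain ⟨f, hf⟩ := hprod
  refine ⟨{p ∈ Theta (D : Set (Fin n × Fin n)) B | polyEval f p = 0}, ⟨f, ?_, rfl⟩, ?_⟩
  · obtain ⟨p, hp, hp'⟩ := hex
    exact ⟨p, hp, by rw [hf]; exact hp'⟩
  · rintro p ⟨hp, hpA⟩ q ⟨hq, -⟩ hpq
    have hpf : polyEval f p ≠ 0 := fun h => hpA ⟨hp, h⟩
    rw [hf, Finset.prod_ne_zero_iff] at hpf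
    have hwf : WellFounded lt := by
      have : IsTrans (Fin n) lt := inferInstance
      have : Std.Irrefl lt := inferInstance
      exact Finite.wellFounded_of_trans_of_irrefl lt
    have hpq' : phi p = phi q := by convert hpq
    have hcol : ∀ v, ∀ u, p.1 u v = q.1 u v := by
      intro v
      induction v using hwf.induction with
      | _ v ih =>
        exact column_eq D B hG hacyc v (y v) (fun i => (hY v).2.1 _ (hyY v i)) p q hp hq hpq'
          (hpf v (Finset.mem_univ _)) fun i hi => ih _ (hlt' v _ (hyY v i) hi)
    have h1 : p.1 = q.1 := by
      ext u v; exact hcol v u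
    have h2 : p.2 = q.2 := by
      rw [← (theta_facts p (theta_nil D B hacyc p hp)).2.2,
        ← (theta_facts q (theta_nil D B hacyc q hq)).2.2, hpq', h1]
    exact Prod.ext h1 h2
end

section
/- Let G = (V,D,B) be an acyclic mixed graph with mixed components G_1, …, G_k. Then G is generically identifiable if and only if every mixed component G_j, j = 1, …, k, is generically identifiable. -/
open scoped Classical Matrix

/-! ### Generic linear algebra -/

section LinAlg

set_option linter.unusedSectionVars false

variable {α : Type} [Fintype α] [DecidableEq α]

/-- strictly upper triangular with respect to a rank function -/
def STri (r : α → ℕ) (Z : Matrix α α ℝ) : Prop := ∀ u v, Z u v ≠ 0 → r u < r v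

theorem STri.pow_le {r : α → ℕ} {Z : Matrix α α ℝ} (h : STri r Z) (k : ℕ) :
    ∀ u v, (Z ^ k) u v ≠ 0 → r u + k ≤ r v := by
  induction k with
  | zero =>
    intro u v huv
    by_cases e : u = v
    · simp [e]
    · simp [e] at huv
  | succ k ih =>
    intro u v huv
    rw [pow_succ, Matrix.mul_apply] at huv
    obtain ⟨w, -, hw⟩ := Finset.exists_ne_zero_of_sum_ne_zero huv
    have h1 := ih u w (left_ne_zero_of_mul hw)
    have h2 := h w v (right_ne_zero_of_mul hw)
    omega

theorem STri.nilp {r : α → ℕ} {Z : Matrix α α ℝ} (h : STri r Z) : IsNilpotent Z := by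
  refine ⟨(∑ v, r v) + 1, ?_⟩
  ext u v
  by_contra hne
  have h1 := h.pow_le _ u v hne
  have h2 : r v ≤ ∑ v, r v := Finset.single_le_sum (fun _ _ => Nat.zero_le _) (Finset.mem_univ v)
  omega

theorem STri.isUnit_det {r : α → ℕ} {Z : Matrix α α ℝ} (h : STri r Z) :
    IsUnit (1 - Z).det :=
  (Matrix.isUnit_iff_isUnit_det _).1 h.nilp.isUnit_one_sub

theorem STri.add {r : α → ℕ} {Y Z : Matrix α α ℝ} (hY : STri r Y) (hZ : STri r Z) :
    STri r (Y + Z) := by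
  intro u v h
  by_contra hlt
  have h1 : Y u v = 0 := by by_contra hh; exact hlt (hY u v hh)
  have h2 : Z u v = 0 := by by_contra hh; exact hlt (hZ u v hh)
  exact h (by simp [h1, h2])

theorem STri.neg {r : α → ℕ} {Z : Matrix α α ℝ} (hZ : STri r Z) : STri r (-Z) := by
  intro u v h
  exact hZ u v (by simpa using h)

theorem STri.sub {r : α → ℕ} {Y Z : Matrix α α ℝ} (hY : STri r Y) (hZ : STri r Z) :
    STri r (Y - Z) := by
  rw [sub_eq_add_neg]; exact hY.add hZ.neg

theorem STri.mul {r : α → ℕ} {Y Z : Matrix α α ℝ} (hY : STri r Y) (hZ : STri r Z) :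
    STri r (Y * Z) := by
  intro u v h
  rw [Matrix.mul_apply] at h
  obtain ⟨w, -, hw⟩ := Finset.exists_ne_zero_of_sum_ne_zero h
  exact (hY u w (left_ne_zero_of_mul hw)).trans (hZ w v (right_ne_zero_of_mul hw))

theorem STri.inv {r : α → ℕ} {Z : Matrix α α ℝ} (hZ : STri r Z) :
    STri r ((1 - Z)⁻¹ - 1) := by
  have hu := hZ.isUnit_det
  have : Invertible (1 - Z) := Matrix.invertibleOfIsUnitDet _ hu
  have hbt : Matrix.BlockTriangular (1 - Z) r := by
    intro i j hij
    have h1 : Z i j = 0 := by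
      by_contra hh
      have := hZ i j hh
      omega
    have h2 : i ≠ j := by rintro rfl; omega
    simp [h1, h2]
  have hinv := Matrix.blockTriangular_inv_of_blockTriangular hbt
  have e : (1 - Z)⁻¹ - 1 = Z * (1 - Z)⁻¹ := by
    have := Matrix.mul_nonsing_inv (1 - Z) hu
    rw [sub_mul, one_mul] at this
    exact sub_eq_iff_eq_add.2 ((sub_eq_iff_eq_add.1 this).trans (add_comm _ _))
  rw [e]
  intro u v h
  rw [Matrix.mul_apply] at h
  obtain ⟨w, -, hw⟩ := Finset.exists_ne_zero_of_sum_ne_zero h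
  have h1 := hZ u w (left_ne_zero_of_mul hw)
  have h2 : ¬ r v < r w := fun hh => right_ne_zero_of_mul hw (hinv hh)
  omega

theorem eq_zero_of_conj {Ω A : Matrix α α ℝ} (hΩ : Ω.PosDef) (h : Aᵀ * Ω * A = 0) : A = 0 := by
  ext i j
  by_contra hne
  have hx : (fun k => A k j) ≠ 0 := fun h0 => hne (congrFun h0 i)
  have hp := hΩ.dotProduct_mulVec_pos hx
  have e : star (fun k => A k j) ⬝ᵥ (Ω *ᵥ (fun k => A k j)) = (Aᵀ * Ω * A) j j := by
    rw [mul_assoc, star_trivial]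
    rfl
  rw [e, h] at hp
  simp at hp

theorem unip_orth {Ω Z : Matrix α α ℝ} (hΩ : Ω.PosDef) (hZ : IsNilpotent Z)
    (h : (1 + Z)ᵀ * Ω * (1 + Z) = Ω) : Z = 0 := by
  obtain ⟨m, hm⟩ := hZ
  have step : ∀ k, Z ^ (k + 2) = 0 → Z ^ (k + 1) = 0 := by
    intro k hk
    have h1 : (1 + Z) * Z ^ (k + 1) = Z ^ (k + 1) := by
      rw [add_mul, one_mul, ← pow_succ', hk, add_zero]
    have h2 : (1 + Z)ᵀ * Ω * Z ^ (k + 1) = Ω * Z ^ (k + 1) := by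
      conv_lhs => rw [← h1]
      rw [← mul_assoc, h]
    have h3 : Zᵀ * Ω * Z ^ (k + 1) = 0 := by
      rw [Matrix.transpose_add, Matrix.transpose_one, add_mul, one_mul, add_mul] at h2
      simpa using h2
    apply eq_zero_of_conj hΩ
    rw [Matrix.transpose_pow, pow_succ, mul_assoc, mul_assoc, ← mul_assoc Zᵀ, h3, mul_zero]
  have all : ∀ k, Z ^ (k + 1) = 0 → Z = 0 := by
    intro k
    induction k with
    | zero => intro h; simpa using h
    | succ k ih => intro h; exact ih (step k h)
  exact all m (by rw [pow_succ, hm, zero_mul])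

theorem phi_eq_of_rel {p q : Matrix α α ℝ × Matrix α α ℝ}
    (hq : IsUnit (1 - q.1).det) (N : Matrix α α ℝ) (h1 : 1 - q.1 = (1 - p.1) * N)
    (h2 : Nᵀ * p.2 * N = q.2) : phi p = phi q := by
  have hN : IsUnit N.det := by
    rw [h1, Matrix.det_mul] at hq
    exact isUnit_of_mul_isUnit_right hq
  have hNN := Matrix.mul_nonsing_inv N hN
  have hNT : (N⁻¹)ᵀ * Nᵀ = 1 := by rw [← Matrix.transpose_mul, hNN, Matrix.transpose_one]
  unfold phi
  rw [h1, Matrix.mul_inv_rev, ← h2, Matrix.transpose_mul]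
  calc ((1 - p.1)⁻¹)ᵀ * p.2 * (1 - p.1)⁻¹
      = ((1 - p.1)⁻¹)ᵀ * ((N⁻¹)ᵀ * Nᵀ) * p.2 * (N * N⁻¹) * (1 - p.1)⁻¹ := by
        rw [hNT, hNN]; simp
    _ = _ := by simp only [mul_assoc]

theorem rel_of_phi_eq {D B : Set (α × α)} {β : Type} [DecidableEq β] (r : α → ℕ) (b : α → β)
    (hr : ∀ u v, (u, v) ∈ D → r u < r v) (hb : ∀ u v, (u, v) ∈ B → b u = b v)
    {p q : Matrix α α ℝ × Matrix α α ℝ} (hp : p ∈ Theta D B) (hq : q ∈ Theta D B)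
    (h : phi p = phi q) :
    ∃ N : Matrix α α ℝ, 1 - q.1 = (1 - p.1) * N ∧ Nᵀ * p.2 * N = q.2 ∧ (∀ v, N v v = 1) ∧
      ∀ v w, b v ≠ b w → N v w = 0 := by
  have sp : STri r p.1 := fun u v huv => hr u v (hp.1 u v huv)
  have sq : STri r q.1 := fun u v huv => hr u v (hq.1 u v huv)
  have up := sp.isUnit_det
  have uq := sq.isUnit_det
  set P := 1 - p.1 with hP
  set Q := 1 - q.1 with hQ
  have PP : P * P⁻¹ = 1 := Matrix.mul_nonsing_inv _ up
  have QQ : Q⁻¹ * Q = 1 := Matrix.nonsing_inv_mul _ uq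
  have PP' : P⁻¹ * P = 1 := Matrix.nonsing_inv_mul _ up
  have QQ' : Q * Q⁻¹ = 1 := Matrix.mul_nonsing_inv _ uq
  have QT : Qᵀ * (Q⁻¹)ᵀ = 1 := by rw [← Matrix.transpose_mul, QQ, Matrix.transpose_one]
  set N := P⁻¹ * Q with hN
  set M := Q⁻¹ * P with hM
  have NM : N * M = 1 := by
    rw [hN, hM, mul_assoc, ← mul_assoc Q, QQ', one_mul, PP']
  have MN : M * N = 1 := by
    rw [hN, hM, mul_assoc, ← mul_assoc P, PP, one_mul, QQ]
  have sN : STri r (N - 1) := by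
    have e : N - 1 = (P⁻¹ - 1) * (p.1 - q.1) + (p.1 - q.1) := by
      have : p.1 - q.1 = Q - P := by rw [hP, hQ]; abel
      rw [this, sub_mul, one_mul, sub_add_cancel, mul_sub, PP']
    rw [e]
    exact (sp.inv.mul (sp.sub sq)).add (sp.sub sq)
  have sM : STri r (M - 1) := by
    have e : M - 1 = (Q⁻¹ - 1) * (q.1 - p.1) + (q.1 - p.1) := by
      have : q.1 - p.1 = P - Q := by rw [hP, hQ]; abel
      rw [this, sub_mul, one_mul, sub_add_cancel, mul_sub, QQ]
    rw [e]
    exact (sq.inv.mul (sq.sub sp)).add (sq.sub sp)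
  have hrel : Nᵀ * p.2 * N = q.2 := by
    have h' : (P⁻¹)ᵀ * p.2 * P⁻¹ = (Q⁻¹)ᵀ * q.2 * Q⁻¹ := h
    calc Nᵀ * p.2 * N = Qᵀ * ((P⁻¹)ᵀ * p.2 * P⁻¹) * Q := by
          rw [hN, Matrix.transpose_mul]; simp only [mul_assoc]
      _ = (Qᵀ * (Q⁻¹)ᵀ) * q.2 * (Q⁻¹ * Q) := by rw [h']; simp only [mul_assoc]
      _ = q.2 := by rw [QT, QQ]; simp
  refine ⟨N, ?_, hrel, ?_, ?_⟩
  · rw [hN, ← mul_assoc, PP, one_mul]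
  · intro v
    by_contra hne
    have := sN v v (by simpa [sub_eq_zero] using hne)
    omega
  · intro v w hvw
    let s : α → ℝ := fun u => if b u = b v then -1 else 1
    have ss : ∀ u, s u * s u = 1 := by intro u; simp only [s]; split_ifs <;> norm_num
    let S : Matrix α α ℝ := Matrix.diagonal s
    have SS : S * S = 1 := by
      simp only [S, Matrix.diagonal_mul_diagonal, ss, Matrix.diagonal_one]
    have ST : Sᵀ = S := Matrix.diagonal_transpose s
    have hconj : ∀ q ∈ Theta D B, S * q.2 * S = q.2 := by
      intro q hq
      ext x y
      simp only [S, Matrix.mul_diagonal, Matrix.diagonal_mul]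
      by_cases hxy : q.2 x y = 0
      · simp [hxy]
      · have : s x = s y := by
          by_cases e : x = y
          · rw [e]
          · have := hb x y (hq.2.2 x y e hxy)
            simp only [s, this]
        rw [this, mul_right_comm, ss, one_mul]
    have hS : (S * N * S)ᵀ * p.2 * (S * N * S) = q.2 := by
      calc (S * N * S)ᵀ * p.2 * (S * N * S) = S * (Nᵀ * (S * p.2 * S) * N) * S := by
            simp only [Matrix.transpose_mul, ST, mul_assoc]
        _ = q.2 := by rw [hconj p hp, hrel, hconj q hq]
    let Z := (S * N * S - N) * M
    have hZ1 : 1 + Z = S * N * S * M := by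
      simp only [Z, sub_mul, NM]; abel
    have sD : STri r (S * N * S - N) := by
      intro x y hxy
      apply sN
      intro h0
      apply hxy
      rw [Matrix.sub_apply, sub_eq_zero] at h0
      simp only [S, Matrix.sub_apply, Matrix.mul_diagonal, Matrix.diagonal_mul, h0]
      by_cases e : x = y
      · subst e; simp [ss]
      · simp [e]
    have sZ : STri r Z := by
      have : Z = (S * N * S - N) * (M - 1) + (S * N * S - N) := by
        simp only [Z, mul_sub, mul_one]; abel
      rw [this]
      exact (sD.mul sM).add sD
    have hZ : Z = 0 := by
      apply unip_orth hp.2.1 sZ.nilp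
      rw [hZ1]
      calc (S * N * S * M)ᵀ * p.2 * (S * N * S * M)
          = Mᵀ * ((S * N * S)ᵀ * p.2 * (S * N * S)) * M := by
            rw [Matrix.transpose_mul (S * N * S) M]; simp only [mul_assoc]
        _ = (N * M)ᵀ * p.2 * (N * M) := by
            rw [hS, ← hrel, Matrix.transpose_mul N M]; simp only [mul_assoc]
        _ = p.2 := by rw [NM]; simp
    have hfin : S * N * S = N := by
      have : S * N * S * M * N = N := by rw [← hZ1, hZ]; simp
      rwa [mul_assoc _ M N, MN, mul_one] at this
    have := congrFun (congrFun hfin v) w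
    have hw : ¬ b w = b v := fun e => hvw e.symm
    simp only [S, Matrix.mul_diagonal, Matrix.diagonal_mul, s, if_true, if_neg hw] at this
    linarith

theorem posDef_of_blocks {β : Type} [Fintype β] [DecidableEq β] (b : α → β) (Ω : Matrix α α ℝ)
    (hoff : ∀ v w, b v ≠ b w → Ω v w = 0)
    (hblk : ∀ k : β, ∃ (γ : Type) (_ : Fintype γ) (Y : Matrix γ γ ℝ) (e : {v // b v = k} → γ),
      Function.Injective e ∧ Y.PosDef ∧ ∀ v w : {v // b v = k}, Ω v w = Y (e v) (e w)) :
    Ω.PosDef := by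
  have hb : ∀ k : β, (Ω.submatrix (Subtype.val : {v // b v = k} → α) Subtype.val).PosDef := by
    intro k
    obtain ⟨γ, _, Y, e, he, hY, hh⟩ := hblk k
    have := hY.submatrix he
    convert this using 1
    ext v w
    exact hh v w
  refine Matrix.PosDef.of_dotProduct_mulVec_pos ?_ ?_
  · ext v w
    simp only [Matrix.conjTranspose_apply, star_trivial]
    by_cases e : b v = b w
    · exact ((hb (b w)).1.apply ⟨v, e⟩ ⟨w, rfl⟩)
    · rw [hoff v w e, hoff w v (Ne.symm e)]
  · intro x hx
    have key : star x ⬝ᵥ (Ω *ᵥ x) = ∑ k : β, (fun v : {v // b v = k} => x v) ⬝ᵥ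
        ((Ω.submatrix (Subtype.val : {v // b v = k} → α) Subtype.val) *ᵥ
          (fun v : {v // b v = k} => x v)) := by
      simp only [dotProduct, Matrix.mulVec, star_trivial, Matrix.submatrix_apply]
      rw [← (Equiv.sigmaFiberEquiv b).sum_comp, Fintype.sum_sigma]
      refine Finset.sum_congr rfl fun k _ => Finset.sum_congr rfl fun v _ => ?_
      congr 1
      rw [← (Equiv.sigmaFiberEquiv b).sum_comp, Fintype.sum_sigma]
      rw [Finset.sum_eq_single k]
      · rfl
      · intro k' _ hk'
        refine Finset.sum_eq_zero fun w _ => ?_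
        have : Ω v.1 w.1 = 0 := hoff _ _ (by rw [v.2, w.2]; exact Ne.symm hk')
        simp [Equiv.sigmaFiberEquiv, this]
      · simp
    rw [key]
    obtain ⟨u, hu⟩ := Function.ne_iff.1 hx
    refine Finset.sum_pos' (fun k _ => ?_) ⟨b u, Finset.mem_univ _, ?_⟩
    · have := (hb k).posSemidef.dotProduct_mulVec_nonneg (fun v : {v // b v = k} => x v)
      simpa using this
    · have := (hb (b u)).dotProduct_mulVec_pos (x := fun v : {v // b v = b u} => x v)
        (fun h0 => hu (congrFun h0 ⟨u, rfl⟩))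
      simpa using this

end LinAlg

/-- pulling back a polynomial along a coordinatewise polynomial map -/
theorem exists_poly_comp {α β : Type} [Fintype α] [Fintype β]
    (T : Matrix β β ℝ × Matrix β β ℝ → Matrix α α ℝ × Matrix α α ℝ)
    (h1 : ∀ v w, ∃ g, ∀ p, polyEval g p = (T p).1 v w)
    (h2 : ∀ v w, ∃ g, ∀ p, polyEval g p = (T p).2 v w)
    (f : MvPolynomial ((α × α) ⊕ (α × α)) ℝ) :
    ∃ g : MvPolynomial ((β × β) ⊕ (β × β)) ℝ, ∀ p, polyEval g p = polyEval f (T p) := by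
  choose g1 hg1 using h1
  choose g2 hg2 using h2
  refine ⟨MvPolynomial.bind₁ (Sum.elim (fun e => g1 e.1 e.2) (fun e => g2 e.1 e.2)) f, ?_⟩
  intro p
  unfold polyEval
  rw [← MvPolynomial.coe_aeval_eq_eval, ← MvPolynomial.coe_aeval_eq_eval]
  simp only [RingHom.coe_coe]
  rw [MvPolynomial.aeval_bind₁]
  congr 2
  funext x
  rcases x with e | e
  · exact hg1 e.1 e.2 p
  · exact hg2 e.1 e.2 p

theorem poly_const {β : Type} [Fintype β] (c : ℝ) :
    ∃ g : MvPolynomial ((β × β) ⊕ (β × β)) ℝ, ∀ p, polyEval g p = c :=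
  ⟨MvPolynomial.C c, fun p => by simp [polyEval]⟩

theorem poly_fst {β : Type} [Fintype β] (v w : β) :
    ∃ g : MvPolynomial ((β × β) ⊕ (β × β)) ℝ, ∀ p, polyEval g p = p.1 v w :=
  ⟨MvPolynomial.X (Sum.inl (v, w)), fun p => by simp [polyEval]⟩

theorem poly_snd {β : Type} [Fintype β] (v w : β) :
    ∃ g : MvPolynomial ((β × β) ⊕ (β × β)) ℝ, ∀ p, polyEval g p = p.2 v w :=
  ⟨MvPolynomial.X (Sum.inr (v, w)), fun p => by simp [polyEval]⟩

/-! ### Graph part -/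

section Graph

set_option linter.unusedSectionVars false

variable {n : ℕ} {D B : Finset (Fin n × Fin n)} {c : Fin n}

theorem exists_rank_s9 (hacyc : Acyclic D) :
    ∃ r : Fin n → ℕ, ∀ u v, (u, v) ∈ D → r u < r v := by
  refine ⟨fun v => (Finset.univ.filter
    fun u => Relation.TransGen (fun a b => (a, b) ∈ D) u v).card, ?_⟩
  intro u v huv
  apply Finset.card_lt_card
  rw [Finset.ssubset_iff_of_subset]
  · exact ⟨u, by simpa using Relation.TransGen.single huv, by simpa using hacyc u⟩
  · intro x hx
    simp only [Finset.mem_filter, Finset.mem_univ, true_and] at hx ⊢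
    exact hx.tail huv

theorem mem_Cset {w : Fin n} : w ∈ Cset B c ↔ bidirConn B c w := by simp [Cset]

theorem self_mem_Cset : c ∈ Cset B c := mem_Cset.2 Relation.ReflTransGen.refl

theorem bidirConn_symm (hG : IsMixedGraph D B) {u v : Fin n} (h : bidirConn B u v) :
    bidirConn B v u := by
  unfold bidirConn at *
  induction h with
  | refl => exact Relation.ReflTransGen.refl
  | tail _ h2 ih => exact Relation.ReflTransGen.head (hG.1 _ _ h2) ih

theorem Cset_eq_of_conn (hG : IsMixedGraph D B) {u v : Fin n} (h : bidirConn B u v) :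
    Cset B u = Cset B v := by
  ext x
  rw [mem_Cset, mem_Cset]
  exact ⟨fun hx => (bidirConn_symm hG h).trans hx, fun hx => h.trans hx⟩

theorem Cset_closed {u v : Fin n} (hu : u ∈ Cset B c) (h : (u, v) ∈ B) : v ∈ Cset B c :=
  mem_Cset.2 ((mem_Cset.1 hu).tail h)

theorem Cset_sub {v : Fin n} (h : v ∈ Cset B c) : v ∈ Vset D B c :=
  Finset.mem_union_left _ h

theorem pa_mem_Vset {v w : Fin n} (h : (v, w) ∈ D) (hw : w ∈ Cset B c) : v ∈ Vset D B c :=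
  Finset.mem_union_right _ (by simpa using ⟨w, hw, h⟩)

/-- extension by zero -/
noncomputable def extM {V : Finset (Fin n)} (X : Matrix V V ℝ) : Matrix (Fin n) (Fin n) ℝ :=
  fun v w => if h : v ∈ V ∧ w ∈ V then X ⟨v, h.1⟩ ⟨w, h.2⟩ else 0

theorem extM_coe {V : Finset (Fin n)} (X : Matrix V V ℝ) (v w : V) :
    extM X (v : Fin n) (w : Fin n) = X v w := by
  simp [extM]

theorem extM_of_mem {V : Finset (Fin n)} (X : Matrix V V ℝ) {v w : Fin n} (hv : v ∈ V)
    (hw : w ∈ V) : extM X v w = X ⟨v, hv⟩ ⟨w, hw⟩ := by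
  simp [extM, hv, hw]

theorem extM_not {V : Finset (Fin n)} (X : Matrix V V ℝ) {v w : Fin n} (hv : v ∉ V) :
    extM X v w = 0 := by
  simp [extM, hv]

theorem sumV {V : Finset (Fin n)} (F : Fin n → ℝ) (h : ∀ u, u ∉ V → F u = 0) :
    ∑ u, F u = ∑ u : V, F u := by
  rw [Finset.sum_coe_sort V F]
  exact (Finset.sum_subset (Finset.subset_univ V) (fun x _ hx => h x hx)).symm

theorem conj_apply {α : Type} [Fintype α] (N Ω : Matrix α α ℝ) (v w : α) :
    (Nᵀ * Ω * N) v w = ∑ u, N u v * ∑ t, Ω u t * N t w := by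
  rw [mul_assoc]; rfl

/-- restriction of parameters to a mixed component, with given diagonal on the parents -/
noncomputable def resT (D B : Finset (Fin n × Fin n)) (c : Fin n) (d : Vset D B c → ℝ)
    (p : Matrix (Fin n) (Fin n) ℝ × Matrix (Fin n) (Fin n) ℝ) :
    Matrix (Vset D B c) (Vset D B c) ℝ × Matrix (Vset D B c) (Vset D B c) ℝ :=
  (fun v w => if (w : Fin n) ∈ Cset B c then p.1 v w else 0,
   fun v w => if (v : Fin n) ∈ Cset B c ∧ (w : Fin n) ∈ Cset B c then p.2 v w
     else if v = w then d v else 0)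

/-- gluing component parameters into a full parameter -/
noncomputable def glueT (D B : Finset (Fin n × Fin n)) (c : Fin n)
    (p0 : Matrix (Fin n) (Fin n) ℝ × Matrix (Fin n) (Fin n) ℝ)
    (p : Matrix (Vset D B c) (Vset D B c) ℝ × Matrix (Vset D B c) (Vset D B c) ℝ) :
    Matrix (Fin n) (Fin n) ℝ × Matrix (Fin n) (Fin n) ℝ :=
  (fun v w => if w ∈ Cset B c then extM p.1 v w else p0.1 v w,
   fun v w => if v ∈ Cset B c ∧ w ∈ Cset B c then extM p.2 v w
     else if v ∈ Cset B c ∨ w ∈ Cset B c then 0 else p0.2 v w)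

/-- labels of the bidirected components of a mixed component -/
noncomputable def lab (D B : Finset (Fin n × Fin n)) (c : Fin n) (v : Vset D B c) :
    Option (Vset D B c) :=
  if (v : Fin n) ∈ Cset B c then none else some v

theorem lab_ne {u v : Vset D B c} (hv : (v : Fin n) ∉ Cset B c) (h : u ≠ v) :
    lab D B c u ≠ lab D B c v := by
  unfold lab
  rw [if_neg hv]
  split_ifs
  · simp
  · simpa using h

theorem lab_ne' {u v : Vset D B c} (hu : (u : Fin n) ∉ Cset B c) (hv : (v : Fin n) ∈ Cset B c) :
    lab D B c u ≠ lab D B c v := by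
  unfold lab
  simp [hu, hv]

theorem resT_mem {d : Vset D B c → ℝ} (hd : ∀ v, 0 < d v)
    {p : Matrix (Fin n) (Fin n) ℝ × Matrix (Fin n) (Fin n) ℝ}
    (hp : p ∈ Theta (↑D : Set (Fin n × Fin n)) ↑B) :
    resT D B c d p ∈ Theta (compD D B c) (compB D B c) := by
  refine ⟨?_, ?_, ?_⟩
  · intro v w h
    simp only [resT, ne_eq, ite_eq_right_iff, not_forall] at h
    obtain ⟨hw, h⟩ := h
    exact ⟨hp.1 _ _ h, hw⟩
  · refine posDef_of_blocks (lab D B c) _ ?_ ?_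
    · intro v w h
      simp only [resT]
      rw [if_neg, if_neg]
      · rintro rfl; exact h rfl
      · rintro ⟨hv, hw⟩; exact h (by simp [lab, hv, hw])
    · rintro (_ | u)
      · refine ⟨Fin n, inferInstance, p.2, fun v => v.1.1, ?_, hp.2.1, ?_⟩
        · intro v w h; exact Subtype.ext (Subtype.ext h)
        · rintro ⟨v, hv⟩ ⟨w, hw⟩
          have hv' : (v : Fin n) ∈ Cset B c := by
            by_contra hh; simp [lab, hh] at hv
          have hw' : (w : Fin n) ∈ Cset B c := by
            by_contra hh; simp [lab, hh] at hw
          simp [resT, hv', hw']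
      · refine ⟨Vset D B c, inferInstance, Matrix.diagonal d, fun v => v.1,
          Subtype.val_injective, Matrix.PosDef.diagonal hd, ?_⟩
        rintro ⟨v, hv⟩ ⟨w, hw⟩
        have hv' : (v : Fin n) ∉ Cset B c := by
          intro hh; simp [lab, hh] at hv
        simp [resT, hv', Matrix.diagonal_apply]
  · intro v w hvw h
    simp only [resT, if_neg hvw, ne_eq, ite_eq_right_iff, not_forall] at h
    obtain ⟨⟨hv, hw⟩, h⟩ := h
    exact ⟨hp.2.2 _ _ (fun e => hvw (Subtype.ext e)) h, hv, hw⟩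

theorem glueT_mem {p0 : Matrix (Fin n) (Fin n) ℝ × Matrix (Fin n) (Fin n) ℝ}
    (hp0 : p0 ∈ Theta (↑D : Set (Fin n × Fin n)) ↑B)
    {p : Matrix (Vset D B c) (Vset D B c) ℝ × Matrix (Vset D B c) (Vset D B c) ℝ}
    (hp : p ∈ Theta (compD D B c) (compB D B c)) :
    glueT D B c p0 p ∈ Theta (↑D : Set (Fin n × Fin n)) ↑B := by
  refine ⟨?_, ?_, ?_⟩
  · intro v w h
    by_cases hw : w ∈ Cset B c
    · by_cases hv : v ∈ Vset D B c
      · simp only [glueT, if_pos hw, extM_of_mem _ hv (Cset_sub hw)] at h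
        exact (hp.1 _ _ h).1
      · simp [glueT, extM_not _ hv] at h
        exact absurd hw h.1
    · simp only [glueT, if_neg hw] at h
      exact hp0.1 _ _ h
  · refine posDef_of_blocks (fun v => decide (v ∈ Cset B c)) _ ?_ ?_
    · intro v w h
      by_cases hv : v ∈ Cset B c <;> by_cases hw : w ∈ Cset B c <;> simp [hv, hw] at h
      · simp [glueT, hv, hw]
      · simp [glueT, hv, hw]
    · rintro (_ | _)
      · refine ⟨Fin n, inferInstance, p0.2, fun v => v.1, Subtype.val_injective, hp0.2.1, ?_⟩
        rintro ⟨v, hv⟩ ⟨w, hw⟩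
        simp only [decide_eq_false_iff_not] at hv hw
        simp [glueT, hv, hw]
      · refine ⟨Vset D B c, inferInstance, p.2,
          fun v => ⟨v.1, Cset_sub (by simpa using v.2)⟩, ?_, hp.2.1, ?_⟩
        · intro v w h; exact Subtype.ext (by simpa using h)
        · rintro ⟨v, hv⟩ ⟨w, hw⟩
          simp only [decide_eq_true_eq] at hv hw
          simp [glueT, hv, hw, extM_of_mem _ (Cset_sub (D := D) hv) (Cset_sub (D := D) hw)]
  · intro v w hvw h
    by_cases hv : v ∈ Cset B c <;> by_cases hw : w ∈ Cset B c
    · simp only [glueT, hv, hw, and_self, if_true, extM_of_mem _ (Cset_sub (D := D) hv)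
        (Cset_sub (D := D) hw)] at h
      exact (hp.2.2 _ _ (fun e => hvw (by simpa using e)) h).1
    · simp [glueT, hv, hw] at h
    · simp [glueT, hv, hw] at h
    · simp only [glueT, hv, hw, and_self, or_self, if_false] at h
      exact hp0.2.2 _ _ hvw h

theorem comp_rank {r : Fin n → ℕ} (hr : ∀ u v, (u, v) ∈ D → r u < r v) :
    ∀ u v : Vset D B c, (u, v) ∈ compD D B c → r u < r v := fun _ _ h => hr _ _ h.1

/-- equal images in `G` give equal images in each mixed component -/
theorem res_phi (hG : IsMixedGraph D B) (hacyc : Acyclic D) {d : Vset D B c → ℝ}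
    (hd : ∀ v, 0 < d v)
    {p q : Matrix (Fin n) (Fin n) ℝ × Matrix (Fin n) (Fin n) ℝ}
    (hp : p ∈ Theta (↑D : Set (Fin n × Fin n)) ↑B)
    (hq : q ∈ Theta (↑D : Set (Fin n × Fin n)) ↑B) (h : phi p = phi q) :
    phi (resT D B c d p) = phi (resT D B c d q) := by
  obtain ⟨r, hr⟩ := exists_rank_s9 hacyc
  obtain ⟨N, h1, h2, -, h4⟩ := rel_of_phi_eq r (Cset B) (fun u v huv => hr u v huv)
    (fun u v huv => Cset_eq_of_conn hG (Relation.ReflTransGen.single huv)) hp hq h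
  have hN : ∀ u w, u ∉ Cset B c → w ∈ Cset B c → N u w = 0 := by
    intro u w hu hw
    apply h4
    intro e
    have hc := Cset_eq_of_conn hG (mem_Cset.1 hw)
    rw [hc, ← e] at hu
    exact hu self_mem_Cset
  have sq : STri (fun v : Vset D B c => r v) (resT D B c d q).1 :=
    fun u v huv => comp_rank hr u v ((resT_mem hd hq).1 u v huv)
  let M : Matrix (Vset D B c) (Vset D B c) ℝ := fun u w =>
    if (w : Fin n) ∈ Cset B c then N u w else (1 : Matrix (Vset D B c) (Vset D B c) ℝ) u w
  have one_eq : ∀ v w : Vset D B c, (1 : Matrix (Vset D B c) (Vset D B c) ℝ) v w =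
      (1 : Matrix (Fin n) (Fin n) ℝ) v w := by
    intro v w
    simp only [Matrix.one_apply, Subtype.ext_iff]
  refine phi_eq_of_rel sq.isUnit_det M ?_ ?_
  · ext v w
    by_cases hw : (w : Fin n) ∈ Cset B c
    · have e := congrFun (congrFun h1 v) w
      rw [Matrix.mul_apply, sumV (V := Vset D B c)] at e
      · have l : (1 - (resT D B c d q).1) v w = (1 - q.1) v w := by
          simp only [Matrix.sub_apply]; simp only [resT, hw, if_true, one_eq]
        rw [l, e, Matrix.mul_apply]
        refine Finset.sum_congr rfl fun u _ => ?_
        by_cases hu : (u : Fin n) ∈ Cset B c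
        · simp only [Matrix.sub_apply]; simp only [resT, hw, hu, if_true, one_eq, M]
        · simp [M, hw, hN u w hu hw]
      · intro u hu
        rw [hN u w (fun hh => hu (Cset_sub hh)) hw, mul_zero]
    · have : ((1 - (resT D B c d p).1) * M) v w =
          ((1 - (resT D B c d p).1) * (1 : Matrix (Vset D B c) (Vset D B c) ℝ)) v w := by
        rw [Matrix.mul_apply, Matrix.mul_apply]
        refine Finset.sum_congr rfl fun u _ => ?_
        simp [M, hw]
      rw [this, mul_one]
      simp only [Matrix.sub_apply]; simp [resT, hw]
  · ext v w
    rw [conj_apply]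
    by_cases hv : (v : Fin n) ∈ Cset B c
    · by_cases hw : (w : Fin n) ∈ Cset B c
      · have e := congrFun (congrFun h2 v) w
        have l : (resT D B c d q).2 v w = q.2 v w := by simp [resT, hv, hw]
        rw [l, ← e, conj_apply, sumV (V := Vset D B c)]
        · refine Finset.sum_congr rfl fun u _ => ?_
          by_cases hu : (u : Fin n) ∈ Cset B c
          · rw [sumV (V := Vset D B c)]
            · congr 1
              · simp [M, hv]
              · refine Finset.sum_congr rfl fun t _ => ?_
                by_cases ht : (t : Fin n) ∈ Cset B c
                · simp [resT, hu, ht, M, hw]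
                · simp [M, hw, hN t w ht hw]
            · intro t ht
              rw [hN t w (fun hh => ht (Cset_sub hh)) hw, mul_zero]
          · simp [M, hv, hN u v hu hv]
        · intro u hu
          rw [hN u v (fun hh => hu (Cset_sub hh)) hv, zero_mul]
      · have l : (resT D B c d q).2 v w = 0 := by
          have : v ≠ w := by rintro rfl; exact hw hv
          simp [resT, hw, this]
        rw [l]
        refine Finset.sum_eq_zero fun u _ => ?_
        by_cases hu : (u : Fin n) ∈ Cset B c
        · have : u ≠ w := by rintro rfl; exact hw hu
          simp [M, hw, Matrix.one_apply, resT, this]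
        · simp [M, hv, hN u v hu hv]
    · have hM : ∀ u, M u v = if u = v then 1 else 0 := by
        intro u; simp [M, hv, Matrix.one_apply]
      simp only [hM, ite_mul, one_mul, zero_mul, Finset.sum_ite_eq', Finset.mem_univ, if_true]
      have hO : ∀ t, (resT D B c d p).2 v t = if v = t then d v else 0 := by
        intro t; simp [resT, hv]
      simp only [hO, ite_mul, zero_mul, Finset.sum_ite_eq, Finset.mem_univ, if_true]
      by_cases hw : (w : Fin n) ∈ Cset B c
      · have : v ≠ w := by rintro rfl; exact hv hw
        simp [M, hw, hN v w hv hw, resT, hv, this]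
      · simp [M, hw, Matrix.one_apply, resT, hv]

/-- equal images in a mixed component give equal images in `G` after gluing -/
theorem glue_phi (hacyc : Acyclic D)
    {p0 : Matrix (Fin n) (Fin n) ℝ × Matrix (Fin n) (Fin n) ℝ}
    (hp0 : p0 ∈ Theta (↑D : Set (Fin n × Fin n)) ↑B)
    {p q : Matrix (Vset D B c) (Vset D B c) ℝ × Matrix (Vset D B c) (Vset D B c) ℝ}
    (hp : p ∈ Theta (compD D B c) (compB D B c))
    (hq : q ∈ Theta (compD D B c) (compB D B c)) (h : phi p = phi q) :
    phi (glueT D B c p0 p) = phi (glueT D B c p0 q) ∧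
      ∀ v : Vset D B c, (v : Fin n) ∉ Cset B c → p.2 v v = q.2 v v := by
  obtain ⟨r, hr⟩ := exists_rank_s9 hacyc
  obtain ⟨M, h1, h2, h3, h4⟩ := rel_of_phi_eq (fun v : Vset D B c => r v) (lab D B c)
    (comp_rank hr) (fun u v huv => by simp [lab, huv.2.1, huv.2.2]) hp hq h
  have hM : ∀ u w : Vset D B c, (u : Fin n) ∉ Cset B c → (w : Fin n) ∈ Cset B c →
      M u w = 0 := fun u w hu hw => h4 u w (lab_ne' hu hw)
  have sq : STri r (glueT D B c p0 q).1 :=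
    fun u v huv => hr u v ((glueT_mem hp0 hq).1 u v huv)
  let N : Matrix (Fin n) (Fin n) ℝ := fun u w =>
    if w ∈ Cset B c then extM M u w else (1 : Matrix (Fin n) (Fin n) ℝ) u w
  have hN : ∀ u w, u ∉ Cset B c → w ∈ Cset B c → N u w = 0 := by
    intro u w hu hw
    simp only [N, if_pos hw]
    by_cases hu' : u ∈ Vset D B c
    · rw [extM_of_mem _ hu' (Cset_sub hw)]
      exact hM _ _ hu hw
    · exact extM_not _ hu'
  have hNM : ∀ u w : Vset D B c, (w : Fin n) ∈ Cset B c → N u w = M u w := by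
    intro u w hw
    simp [N, hw, extM_coe]
  have one_eq : ∀ v w : Vset D B c, (1 : Matrix (Fin n) (Fin n) ℝ) v w =
      (1 : Matrix (Vset D B c) (Vset D B c) ℝ) v w := by
    intro v w
    simp only [Matrix.one_apply, Subtype.ext_iff]
  have g1 : ∀ (p : Matrix (Vset D B c) (Vset D B c) ℝ × Matrix (Vset D B c) (Vset D B c) ℝ)
      (v w : Vset D B c), (w : Fin n) ∈ Cset B c →
      (1 - (glueT D B c p0 p).1) v w = (1 - p.1) v w := by
    intro p v w hw
    simp only [Matrix.sub_apply]; simp only [glueT, hw, if_true, extM_coe, one_eq]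
  have g2 : ∀ (p : Matrix (Vset D B c) (Vset D B c) ℝ × Matrix (Vset D B c) (Vset D B c) ℝ)
      (v w : Vset D B c), (v : Fin n) ∈ Cset B c → (w : Fin n) ∈ Cset B c →
      (glueT D B c p0 p).2 v w = p.2 v w := by
    intro p v w hv hw
    simp [glueT, hv, hw, extM_coe]
  constructor
  · refine phi_eq_of_rel sq.isUnit_det N ?_ ?_
    · ext v w
      by_cases hw : w ∈ Cset B c
      · by_cases hv : v ∈ Vset D B c
        · lift v to Vset D B c using hv
          obtain ⟨w', rfl⟩ : ∃ w' : Vset D B c, (w' : Fin n) = w := ⟨⟨w, Cset_sub hw⟩, rfl⟩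
          rw [g1 q v w' hw, h1, Matrix.mul_apply, Matrix.mul_apply, sumV (V := Vset D B c)]
          · refine Finset.sum_congr rfl fun u _ => ?_
            by_cases hu : (u : Fin n) ∈ Cset B c
            · rw [g1 p v u hu, hNM u w' hw]
            · rw [hM u w' hu hw, hN _ _ hu hw]; simp
          · intro u hu
            rw [hN u _ (fun hh => hu (Cset_sub hh)) hw, mul_zero]
        · have z : ∀ (p : Matrix (Vset D B c) (Vset D B c) ℝ ×
              Matrix (Vset D B c) (Vset D B c) ℝ) u, u ∈ Cset B c →
              (1 - (glueT D B c p0 p).1) v u = 0 := by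
            intro p u hu
            have : v ≠ u := by rintro rfl; exact hv (Cset_sub hu)
            simp only [Matrix.sub_apply]; simp [glueT, hu, extM_not _ hv, this]
          rw [z q w hw, Matrix.mul_apply]
          refine (Finset.sum_eq_zero fun u _ => ?_).symm
          by_cases hu : u ∈ Cset B c
          · rw [z p u hu, zero_mul]
          · rw [hN u w hu hw, mul_zero]
      · have : ((1 - (glueT D B c p0 p).1) * N) v w =
            ((1 - (glueT D B c p0 p).1) * (1 : Matrix (Fin n) (Fin n) ℝ)) v w := by
          rw [Matrix.mul_apply, Matrix.mul_apply]
          refine Finset.sum_congr rfl fun u _ => ?_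
          simp [N, hw]
        rw [this, mul_one]
        simp only [Matrix.sub_apply]; simp [glueT, hw]
    · ext v w
      rw [conj_apply]
      by_cases hv : v ∈ Cset B c
      · by_cases hw : w ∈ Cset B c
        · obtain ⟨w', rfl⟩ : ∃ w' : Vset D B c, (w' : Fin n) = w := ⟨⟨w, Cset_sub hw⟩, rfl⟩
          obtain ⟨v', rfl⟩ : ∃ v' : Vset D B c, (v' : Fin n) = v := ⟨⟨v, Cset_sub hv⟩, rfl⟩
          rw [g2 q v' w' hv hw, ← h2, conj_apply, sumV (V := Vset D B c)]
          · refine Finset.sum_congr rfl fun u _ => ?_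
            by_cases hu : (u : Fin n) ∈ Cset B c
            · rw [sumV (V := Vset D B c)]
              · rw [hNM u v' hv]
                congr 1
                refine Finset.sum_congr rfl fun t _ => ?_
                by_cases ht : (t : Fin n) ∈ Cset B c
                · rw [g2 p u t hu ht, hNM t w' hw]
                · rw [hM t w' ht hw, hN _ _ ht hw]; simp
              · intro t ht
                rw [hN t _ (fun hh => ht (Cset_sub hh)) hw, mul_zero]
            · rw [hM u v' hu hv, hN _ _ hu hv]; simp
          · intro u hu
            rw [hN u _ (fun hh => hu (Cset_sub hh)) hv, zero_mul]
        · have l : (glueT D B c p0 q).2 v w = 0 := by simp [glueT, hv, hw]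
          rw [l]
          refine Finset.sum_eq_zero fun u _ => ?_
          by_cases hu : u ∈ Cset B c
          · simp [N, hw, Matrix.one_apply, glueT, hu]
          · rw [hN u v hu hv, zero_mul]
      · have hNv : ∀ u, N u v = if u = v then 1 else 0 := by
          intro u; simp [N, hv, Matrix.one_apply]
        simp only [hNv, ite_mul, one_mul, zero_mul, Finset.sum_ite_eq', Finset.mem_univ, if_true]
        by_cases hw : w ∈ Cset B c
        · have l : (glueT D B c p0 q).2 v w = 0 := by simp [glueT, hv, hw]
          rw [l]
          refine Finset.sum_eq_zero fun t _ => ?_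
          by_cases ht : t ∈ Cset B c
          · simp [glueT, hv, ht]
          · rw [hN t w ht hw, mul_zero]
        · simp [N, hw, Matrix.one_apply, glueT, hv]
  · intro v hv
    have hMv : ∀ u, M u v = if u = v then 1 else 0 := by
      intro u
      split_ifs with e
      · rw [e, h3]
      · exact h4 u v (lab_ne hv e)
    have := congrFun (congrFun h2 v) v
    rw [conj_apply] at this
    simpa [hMv] using this

theorem genId_comp (hacyc : Acyclic D)
    (hid : GenId (↑D : Set (Fin n × Fin n)) ↑B) (c : Fin n) :
    GenId (compD D B c) (compB D B c) := by
  obtain ⟨A, ⟨f, ⟨p0, hp0, hf⟩, rfl⟩, hinj⟩ := hid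
  obtain ⟨g, hg⟩ := exists_poly_comp (glueT D B c p0) (by
      intro v w
      by_cases hw : w ∈ Cset B c
      · by_cases hv : v ∈ Vset D B c
        · simp only [glueT, if_pos hw, extM_of_mem _ hv (Cset_sub hw)]
          exact poly_fst _ _
        · simp only [glueT, if_pos hw, extM_not _ hv]
          exact poly_const _
      · simp only [glueT, if_neg hw]
        exact poly_const _) (by
      intro v w
      by_cases hvw : v ∈ Cset B c ∧ w ∈ Cset B c
      · simp only [glueT, if_pos hvw, extM_of_mem _ (Cset_sub (D := D) hvw.1)
          (Cset_sub (D := D) hvw.2)]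
        exact poly_snd _ _
      · simp only [glueT, if_neg hvw]
        exact poly_const _) f
  refine ⟨_, ⟨g, ⟨resT D B c (fun _ => 1) p0, resT_mem (fun _ => one_pos) hp0, ?_⟩, rfl⟩, ?_⟩
  · rw [hg]
    convert hf using 2
    refine Prod.ext ?_ ?_
    · ext v w
      by_cases hw : w ∈ Cset B c
      · by_cases hv : v ∈ Vset D B c
        · simp only [glueT, hw, if_true, extM_of_mem _ hv (Cset_sub hw)]
          simp [resT, hw]
        · have : p0.1 v w = 0 := by
            by_contra hne
            exact hv (pa_mem_Vset (hp0.1 v w hne) hw)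
          simp [glueT, hw, extM_not _ hv, this]
      · simp [glueT, hw]
    · ext v w
      by_cases hv : v ∈ Cset B c <;> by_cases hw : w ∈ Cset B c
      · simp only [glueT, hv, hw, and_self, if_true, extM_of_mem _ (Cset_sub (D := D) hv)
          (Cset_sub (D := D) hw)]
        simp [resT, hv, hw]
      · have : p0.2 v w = 0 := by
          by_contra hne
          have hvw : v ≠ w := by rintro rfl; exact hw hv
          exact hw (Cset_closed hv (hp0.2.2 v w hvw hne))
        simp [glueT, hv, hw, this]
      · have : p0.2 w v = 0 := by
          by_contra hne
          have hvw : w ≠ v := by rintro rfl; exact hv hw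
          exact hv (Cset_closed hw (hp0.2.2 w v hvw hne))
        have hs : p0.2 v w = 0 := by
          rw [← hp0.2.1.isHermitian.apply v w, this, star_zero]
        simp [glueT, hv, hw, hs]
      · simp [glueT, hv, hw]
  · rintro p ⟨hp, hp'⟩ q ⟨hq, hq'⟩ hpq
    obtain ⟨e1, e2⟩ := glue_phi hacyc hp0 hp hq hpq
    have hgp : polyEval f (glueT D B c p0 p) ≠ 0 := fun h0 => hp' ⟨hp, by rw [hg, h0]⟩
    have hgq : polyEval f (glueT D B c p0 q) ≠ 0 := fun h0 => hq' ⟨hq, by rw [hg, h0]⟩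
    have e := hinj _ ⟨glueT_mem hp0 hp, fun h0 => hgp h0.2⟩ _
      ⟨glueT_mem hp0 hq, fun h0 => hgq h0.2⟩ e1
    refine Prod.ext ?_ ?_
    · ext v w
      by_cases hw : (w : Fin n) ∈ Cset B c
      · have := congrFun (congrFun (congrArg Prod.fst e) v) w
        simpa [glueT, hw, extM_coe] using this
      · have z : ∀ p ∈ Theta (compD D B c) (compB D B c), p.1 v w = 0 := by
          intro p hp
          by_contra hne
          exact hw (hp.1 v w hne).2
        rw [z p hp, z q hq]
    · ext v w
      by_cases hvw : (v : Fin n) ∈ Cset B c ∧ (w : Fin n) ∈ Cset B c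
      · have := congrFun (congrFun (congrArg Prod.snd e) v) w
        simpa [glueT, hvw.1, hvw.2, extM_coe] using this
      · by_cases hne : v = w
        · subst hne
          exact e2 v (fun hh => hvw ⟨hh, hh⟩)
        · have z : ∀ p ∈ Theta (compD D B c) (compB D B c), p.2 v w = 0 := by
            intro p hp
            by_contra hh
            exact hvw (hp.2.2 v w hne hh).2
          rw [z p hp, z q hq]

theorem genId_of_comp (hG : IsMixedGraph D B) (hacyc : Acyclic D)
    (hid : ∀ c : Fin n, GenId (compD D B c) (compB D B c)) :
    GenId (↑D : Set (Fin n × Fin n)) ↑B := by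
  have hid' : ∀ c : Fin n, ∃ f, (∃ p ∈ Theta (compD D B c) (compB D B c), polyEval f p ≠ 0) ∧
      ∀ p ∈ Theta (compD D B c) (compB D B c), ∀ q ∈ Theta (compD D B c) (compB D B c),
        polyEval f p ≠ 0 → polyEval f q ≠ 0 → phi p = phi q → p = q := by
    intro c
    obtain ⟨A, ⟨f, hf, rfl⟩, hinj⟩ := hid c
    exact ⟨f, hf, fun p hp q hq h1 h2 => hinj p ⟨hp, fun h => h1 h.2⟩ q ⟨hq, fun h => h2 h.2⟩⟩
  choose f hf hinj using hid'
  choose P hP hfP using hf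
  -- representatives of the bidirected components
  let S : Setoid (Fin n) := ⟨bidirConn B, ⟨fun _ => Relation.ReflTransGen.refl,
    fun h => bidirConn_symm hG h, fun h1 h2 => h1.trans h2⟩⟩
  let rep : Fin n → Fin n := fun v => (Quotient.mk S v).out
  have rep_conn : ∀ v, bidirConn B (rep v) v := fun v => Quotient.mk_out (s := S) v
  have rep_mem : ∀ v, v ∈ Cset B (rep v) := fun v => mem_Cset.2 (rep_conn v)
  have rep_eq : ∀ u v, bidirConn B u v → rep u = rep v := by
    intro u v h
    exact congrArg Quotient.out (Quotient.sound (s := S) h)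
  have rep_of_mem : ∀ u v, v ∈ Cset B (rep u) → rep v = rep u := by
    intro u v h
    exact (rep_eq u v ((bidirConn_symm hG (rep_conn u)).trans (mem_Cset.1 h))).symm
  let d : ∀ c, Vset D B c → ℝ := fun c v => (P c).2 v v
  have hd : ∀ c v, 0 < d c v := fun c v => (hP c).2.1.diag_pos
  -- the assembled point
  let Q : Matrix (Fin n) (Fin n) ℝ × Matrix (Fin n) (Fin n) ℝ :=
    (fun v w => extM (P (rep w)).1 v w,
     fun v w => if rep v = rep w then extM (P (rep w)).2 v w else 0)
  have hQ : Q ∈ Theta (↑D : Set (Fin n × Fin n)) ↑B := by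
    refine ⟨?_, ?_, ?_⟩
    · intro v w h
      by_cases hv : v ∈ Vset D B (rep w)
      · simp only [Q, extM_of_mem _ hv (Cset_sub (rep_mem w))] at h
        exact ((hP _).1 _ _ h).1
      · exact absurd (extM_not _ hv) h
    · refine posDef_of_blocks rep _ ?_ ?_
      · intro v w h
        simp [Q, h]
      · intro k
        refine ⟨Vset D B k, inferInstance, (P k).2,
          fun v => ⟨v.1, Cset_sub (by have := rep_mem v.1; rwa [v.2] at this)⟩, ?_,
          (hP k).2.1, ?_⟩
        · intro v w h; exact Subtype.ext (by simpa using h)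
        · rintro ⟨v, hv⟩ ⟨w, rfl⟩
          simp only [Q, hv, if_true]
          rw [extM_of_mem]
    · intro v w hvw h
      by_cases e : rep v = rep w
      · have hv : v ∈ Cset B (rep w) := e ▸ rep_mem v
        simp only [Q, if_pos e, extM_of_mem _ (Cset_sub (D := D) hv)
          (Cset_sub (D := D) (rep_mem w))] at h
        exact ((hP _).2.2 _ _ (fun e => hvw (by simpa using e)) h).1
      · simp [Q, e] at h
  have hres : ∀ u, resT D B (rep u) (d (rep u)) Q = P (rep u) := by
    intro u
    refine Prod.ext ?_ ?_
    · ext v w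
      by_cases hw : (w : Fin n) ∈ Cset B (rep u)
      · have e := rep_of_mem u w hw
        have : ∀ k, k = rep u → extM (P k).1 v w = (P (rep u)).1 v w := by
          rintro k rfl; exact extM_coe _ _ _
        simp only [resT, if_pos hw, Q]
        exact this _ e
      · simp only [resT, if_neg hw]
        by_contra hne
        exact hw ((hP _).1 _ _ (Ne.symm hne)).2
    · ext v w
      by_cases hvw : (v : Fin n) ∈ Cset B (rep u) ∧ (w : Fin n) ∈ Cset B (rep u)
      · have e := rep_of_mem u w hvw.2
        have e' := rep_of_mem u v hvw.1
        have : ∀ k, k = rep u → extM (P k).2 v w = (P (rep u)).2 v w := by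
          rintro k rfl; exact extM_coe _ _ _
        simp only [resT, if_pos hvw, Q, if_pos (e'.trans e.symm)]
        exact this _ e
      · simp only [resT, if_neg hvw]
        split_ifs with e
        · subst e; rfl
        · by_contra hne
          exact hvw ((hP _).2.2 _ _ e (Ne.symm hne)).2
  have hg : ∀ c, ∃ g, ∀ p, polyEval g p = polyEval (f c) (resT D B c (d c) p) := by
    intro c
    refine exists_poly_comp _ ?_ ?_ _
    · intro v w
      by_cases hw : (w : Fin n) ∈ Cset B c
      · simp only [resT, if_pos hw]; exact poly_fst _ _
      · simp only [resT, if_neg hw]; exact poly_const _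
    · intro v w
      by_cases hvw : (v : Fin n) ∈ Cset B c ∧ (w : Fin n) ∈ Cset B c
      · simp only [resT, if_pos hvw]; exact poly_snd _ _
      · simp only [resT, if_neg hvw]; exact poly_const _
  choose g hg using hg
  let F : MvPolynomial ((Fin n × Fin n) ⊕ (Fin n × Fin n)) ℝ := ∏ u, g (rep u)
  have hF : ∀ p, polyEval F p =
      ∏ u, polyEval (f (rep u)) (resT D B (rep u) (d (rep u)) p) := by
    intro p
    simp only [← hg]
    simp only [F, polyEval, map_prod]
  have hF' : ∀ p, polyEval F p ≠ 0 → ∀ u,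
      polyEval (f (rep u)) (resT D B (rep u) (d (rep u)) p) ≠ 0 := by
    intro p hp u
    rw [hF] at hp
    exact Finset.prod_ne_zero_iff.1 hp u (Finset.mem_univ u)
  refine ⟨_, ⟨F, ⟨Q, hQ, ?_⟩, rfl⟩, ?_⟩
  · rw [hF]
    refine Finset.prod_ne_zero_iff.2 fun u _ => ?_
    rw [hres]
    exact hfP _
  · rintro p ⟨hp, hp'⟩ q ⟨hq, hq'⟩ hpq
    have np : polyEval F p ≠ 0 := fun h0 => hp' ⟨hp, h0⟩
    have nq : polyEval F q ≠ 0 := fun h0 => hq' ⟨hq, h0⟩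
    have key : ∀ u, resT D B (rep u) (d (rep u)) p = resT D B (rep u) (d (rep u)) q := by
      intro u
      exact hinj _ _ (resT_mem (hd _) hp) _ (resT_mem (hd _) hq) (hF' p np u) (hF' q nq u)
        (res_phi hG hacyc (hd _) hp hq hpq)
    refine Prod.ext ?_ ?_
    · ext v w
      by_cases hv : v ∈ Vset D B (rep w)
      · have := congrFun (congrFun (congrArg Prod.fst (key w)) ⟨v, hv⟩)
          ⟨w, Cset_sub (rep_mem w)⟩
        simpa [resT, rep_mem w] using this
      · have z : ∀ p ∈ Theta (↑D : Set (Fin n × Fin n)) ↑B, p.1 v w = 0 := by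
          intro p hp
          by_contra hne
          exact hv (pa_mem_Vset (hp.1 v w hne) (rep_mem w))
        rw [z p hp, z q hq]
    · ext v w
      by_cases hv : v ∈ Cset B (rep w)
      · have := congrFun (congrFun (congrArg Prod.snd (key w)) ⟨v, Cset_sub hv⟩)
          ⟨w, Cset_sub (rep_mem w)⟩
        simpa [resT, rep_mem w, hv] using this
      · have z : ∀ p ∈ Theta (↑D : Set (Fin n × Fin n)) ↑B, p.2 v w = 0 := by
          intro p hp
          by_contra hne
          have hvw : v ≠ w := by rintro rfl; exact hv (rep_mem v)
          exact hv (Cset_closed (rep_mem w) (hG.1 _ _ (hp.2.2 v w hvw hne)))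
        rw [z p hp, z q hq]

end Graph

theorem stmt9 (n : ℕ) (D B : Finset (Fin n × Fin n))
    (hG : IsMixedGraph D B) (hacyc : Acyclic D) :
    GenId (↑D : Set (Fin n × Fin n)) ↑B ↔
      ∀ c : Fin n, GenId (compD D B c) (compB D B c) := by
  exact ⟨fun h c => genId_comp hacyc h c, fun h => genId_of_comp hG hacyc h⟩
end
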